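/- arXiv:1001.4541 — 5 statements merged into one kernel-verified Lean document; each statement's English description precedes it below -/
import Mathlib

section
/- For every t > 0 and θ ∈ ℝ, the following two identities of 2×2 complex matrices hold: (−i·e^{2iθ}/sinh t) · (k_θ⁻¹ · (a_t⁻¹ · Y · a_t) · k_θ) + e^{2iθ} · (k_θ⁻¹ · h · k_θ) + (i·e^{2iθ}·coth t) · Y = h + i·V, and (i·e^{−2iθ}/sinh t) · (k_θ⁻¹ · (a_t⁻¹ · Y · a_t) · k_θ) + e^{−2iθ} · (k_θ⁻¹ · h · k_θ) + (−i·e^{−2iθ}·coth t) · Y = h − i·V. (This is the linear-algebraic content of the lemma expressing the raising operator as R = e^{2iθ₂}(−i csch(t) ∂/∂θ₁ + 2 ∂/∂t + i coth(t) ∂/∂θ₂) and the lowering operator as L = e^{−2iθ₂}(i csch(t) ∂/∂θ₁ + 2 ∂/∂t − i coth(t) ∂/∂θ₂) in Cartan KA⁺K coordinates.) -/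
noncomputable def kmat (θ : ℝ) : Matrix (Fin 2) (Fin 2) ℝ :=
  !![Real.cos θ, Real.sin θ; -Real.sin θ, Real.cos θ]

noncomputable def amat (t : ℝ) : Matrix (Fin 2) (Fin 2) ℝ :=
  !![Real.exp (t/2), 0; 0, Real.exp (-t/2)]

def hmat : Matrix (Fin 2) (Fin 2) ℝ := !![1, 0; 0, -1]
def emat : Matrix (Fin 2) (Fin 2) ℝ := !![0, 1; 0, 0]
def fmat : Matrix (Fin 2) (Fin 2) ℝ := !![0, 0; 1, 0]

def Vmat : Matrix (Fin 2) (Fin 2) ℝ := emat + fmat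
def Ymat : Matrix (Fin 2) (Fin 2) ℝ := emat - fmat

/-- Entrywise coercion to complex matrices. -/
noncomputable def kC (θ : ℝ) : Matrix (Fin 2) (Fin 2) ℂ := (kmat θ).map Complex.ofReal
noncomputable def aC (t : ℝ) : Matrix (Fin 2) (Fin 2) ℂ := (amat t).map Complex.ofReal
noncomputable def hC : Matrix (Fin 2) (Fin 2) ℂ := hmat.map Complex.ofReal
noncomputable def VC : Matrix (Fin 2) (Fin 2) ℂ := Vmat.map Complex.ofReal
noncomputable def YC : Matrix (Fin 2) (Fin 2) ℂ := Ymat.map Complex.ofReal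

theorem kC_eq (θ : ℝ) : kC θ = !![Complex.cos θ, Complex.sin θ; -Complex.sin θ, Complex.cos θ] := by
  ext i j
  fin_cases i <;> fin_cases j <;> simp [kC, kmat]

theorem aC_eq (t : ℝ) : aC t = !![Complex.exp (t/2), 0; 0, Complex.exp (-t/2)] := by
  ext i j
  fin_cases i <;> fin_cases j <;> simp [aC, amat]

theorem hC_eq : hC = !![1, 0; 0, -1] := by
  ext i j
  fin_cases i <;> fin_cases j <;> simp [hC, hmat]

theorem VC_eq : VC = !![0, 1; 1, 0] := by
  ext i j
  fin_cases i <;> fin_cases j <;> simp [VC, Vmat, emat, fmat]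

theorem YC_eq : YC = !![0, 1; -1, 0] := by
  ext i j
  fin_cases i <;> fin_cases j <;> simp [YC, Ymat, emat, fmat]

theorem kC_inv (θ : ℝ) : (kC θ)⁻¹ = !![Complex.cos θ, -Complex.sin θ; Complex.sin θ, Complex.cos θ] := by
  apply Matrix.inv_eq_left_inv
  have h := Complex.sin_sq_add_cos_sq (θ : ℂ)
  ext i j
  fin_cases i <;> fin_cases j <;>
    simp [kC, kmat, Matrix.mul_apply, Fin.sum_univ_two] <;> grind

theorem aC_conj (t : ℝ) : (aC t)⁻¹ * YC * aC t =
    !![0, Complex.cosh t - Complex.sinh t; -(Complex.cosh t + Complex.sinh t), 0] := by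
  have h1 : Complex.exp (t/2) * Complex.exp (-t/2) = 1 := by
    rw [← Complex.exp_add, ← Complex.exp_zero]; congr 1; ring
  have hi : (aC t)⁻¹ = !![Complex.exp (-t/2), 0; 0, Complex.exp (t/2)] := by
    apply Matrix.inv_eq_left_inv
    ext i j
    fin_cases i <;> fin_cases j <;>
      simp [aC, amat, Matrix.mul_apply, Fin.sum_univ_two] <;> linear_combination h1
  have h2 : Complex.exp (t/2) * Complex.exp (t/2) = Complex.exp t := by
    rw [← Complex.exp_add]; congr 1; ring
  have h3 : Complex.exp (-t/2) * Complex.exp (-t/2) = Complex.exp (-t) := by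
    rw [← Complex.exp_add]; congr 1; ring
  rw [hi, aC_eq, YC_eq, Complex.cosh_add_sinh, Complex.cosh_sub_sinh, ← h2, ← h3]
  ext i j
  fin_cases i <;> fin_cases j <;>
    simp [Matrix.mul_apply, Fin.sum_univ_two]

theorem ladder_operator_coefficients (t θ : ℝ) (ht : 0 < t) :
    (-Complex.I * Complex.exp (2 * Complex.I * θ) / Complex.sinh t) •
        ((kC θ)⁻¹ * ((aC t)⁻¹ * YC * aC t) * kC θ) +
      Complex.exp (2 * Complex.I * θ) • ((kC θ)⁻¹ * hC * kC θ) +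
      (Complex.I * Complex.exp (2 * Complex.I * θ) * (Complex.cosh t / Complex.sinh t)) • YC
      = hC + Complex.I • VC ∧
    (Complex.I * Complex.exp (-(2 * Complex.I * θ)) / Complex.sinh t) •
        ((kC θ)⁻¹ * ((aC t)⁻¹ * YC * aC t) * kC θ) +
      Complex.exp (-(2 * Complex.I * θ)) • ((kC θ)⁻¹ * hC * kC θ) +
      (-(Complex.I * Complex.exp (-(2 * Complex.I * θ)) * (Complex.cosh t / Complex.sinh t))) • YC
      = hC - Complex.I • VC := by
  have hs : Complex.sinh t ≠ 0 := by
    rw [← Complex.ofReal_sinh]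
    exact_mod_cast (Real.sinh_pos_iff.mpr ht).ne'
  have h := Complex.sin_sq_add_cos_sq (θ : ℂ)
  have hI := Complex.I_sq
  have e1 : Complex.exp (2 * Complex.I * θ) = (Complex.cos θ + Complex.sin θ * Complex.I) ^ 2 := by
    rw [← Complex.exp_mul_I, ← Complex.exp_nat_mul]; congr 1; push_cast; ring
  have e2 : Complex.exp (-(2 * Complex.I * θ)) =
      (Complex.cos θ - Complex.sin θ * Complex.I) ^ 2 := by
    have := Complex.exp_mul_I (-(θ : ℂ))
    rw [Complex.cos_neg, Complex.sin_neg, neg_mul (Complex.sin _), ← sub_eq_add_neg] at this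
    rw [← this, ← Complex.exp_nat_mul]; congr 1; push_cast; ring
  rw [aC_conj, kC_inv, kC_eq, hC_eq, VC_eq, YC_eq, e1, e2]
  clear e1 e2
  generalize Complex.cos (θ : ℂ) = c at *
  generalize Complex.sin (θ : ℂ) = s at *
  generalize Complex.sinh (t : ℂ) = S at *
  generalize Complex.cosh (t : ℂ) = C at *
  generalize Complex.I = I at *
  constructor
  all_goals
    ext i j
    fin_cases i <;> fin_cases j <;>
      simp [Matrix.mul_apply, Fin.sum_univ_two] <;>
      field_simp <;> grind
end

section
/- Let s ∈ ℝ with 1/2 < s < 1 and let k ∈ ℤ. Then for every x ∈ ℝ, the function y ↦ (y − i)^{k − s}·(y + i)^{−k − s}·|x − y|^{−2(1 − s)} is integrable on ℝ, and ∫_ℝ (y − i)^{k − s}·(y + i)^{−k − s}·|x − y|^{−2(1−s)} dy = (4^{1−s}·π·(−1)^k·Γ(2s − 1)/(Γ(s − k)·Γ(s + k))) · (x − i)^{k − (1 − s)}·(x + i)^{−k − (1 − s)}, where Γ is the Gamma function. -/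
open Complex MeasureTheory

lemma sub_deriv (t : ℝ) (S : Set ℝ) :
    HasDerivWithinAt (fun t : ℝ => (1 - Real.cos t) / 2) (Real.sin t / 2) S t := by
  have := (((Real.hasDerivAt_cos t).const_sub 1).div_const 2).hasDerivWithinAt (s := S)
  simpa using this

lemma sub_inj : Set.InjOn (fun t : ℝ => (1 - Real.cos t) / 2) (Set.Ioo 0 Real.pi) := by
  intro a ha b hb h
  simp only at h
  exact Real.injOn_cos ⟨ha.1.le, ha.2.le⟩ ⟨hb.1.le, hb.2.le⟩ (by linarith)

lemma sub_image : (fun t : ℝ => (1 - Real.cos t) / 2) '' (Set.Ioo 0 Real.pi) = Set.Ioo 0 1 := by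
  ext w
  constructor
  · rintro ⟨t, ht, rfl⟩
    have h1 : Real.cos t < Real.cos 0 :=
      Real.strictAntiOn_cos ⟨le_rfl, Real.pi_pos.le⟩ ⟨ht.1.le, ht.2.le⟩ ht.1
    have h2 : Real.cos Real.pi < Real.cos t :=
      Real.strictAntiOn_cos ⟨ht.1.le, ht.2.le⟩ ⟨Real.pi_pos.le, le_rfl⟩ ht.2
    simp only [Real.cos_zero, Real.cos_pi] at h1 h2
    constructor <;> simp only <;> linarith
  · rintro ⟨h0, h1⟩
    refine ⟨Real.arccos (1 - 2 * w), ⟨?_, ?_⟩, ?_⟩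
    · exact Real.arccos_pos.2 (by linarith)
    · rcases (Real.arccos_le_pi (1 - 2 * w)).lt_or_eq with h | h
      · exact h
      · rw [Real.arccos_eq_pi] at h; linarith
    · simp only
      rw [Real.cos_arccos (by linarith) (by linarith)]; ring

lemma sub_integrand (s t : ℝ) (ht : t ∈ Set.Ioo 0 Real.pi) :
    |Real.sin t / 2| • ((((1 - Real.cos t) / 2 : ℝ) : ℂ) ^ (((s - 1/2 : ℝ) : ℂ) - 1) *
      (1 - (((1 - Real.cos t) / 2 : ℝ) : ℂ)) ^ (((s - 1/2 : ℝ) : ℂ) - 1)) =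
    (((4 : ℝ) ^ (1 - s) : ℝ) : ℂ) * ((Real.sin t ^ (2 * s - 2) : ℝ) : ℂ) := by
  have hsin := Real.sin_pos_of_mem_Ioo ht
  have hw : (1 - Real.cos t) / 2 ∈ Set.Ioo (0:ℝ) 1 := by
    rw [← sub_image]; exact ⟨t, ht, rfl⟩
  set w := (1 - Real.cos t) / 2 with hwdef
  have e1 : (1 - (w : ℂ)) = ((1 - w : ℝ) : ℂ) := by push_cast; ring
  have e2 : (((s - 1/2 : ℝ) : ℂ) - 1) = ((s - 3/2 : ℝ) : ℂ) := by push_cast; ring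
  rw [e1, e2, ← ofReal_cpow hw.1.le, ← ofReal_cpow (by linarith [hw.2]), real_smul]
  norm_cast
  rw [← Real.mul_rpow hw.1.le (by linarith [hw.2]), abs_of_pos (by positivity)]
  have e3 : w * (1 - w) = (Real.sin t / 2) ^ (2:ℝ) := by
    rw [Real.rpow_two, hwdef]
    nlinarith [Real.sin_sq_add_cos_sq t]
  rw [e3, ← Real.rpow_mul (by positivity)]
  nth_rw 1 [← Real.rpow_one (Real.sin t / 2)]
  rw [← Real.rpow_add (by positivity), show 1 + 2 * (s - 3/2) = 2 * s - 2 by ring,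
    Real.div_rpow hsin.le (by norm_num), show (4:ℝ) = 2 ^ (2:ℝ) by norm_num,
    ← Real.rpow_mul (by norm_num), div_eq_mul_inv, ← Real.rpow_neg (by norm_num), mul_comm]
  congr 2; ring

lemma base_int (s : ℝ) (hs : 1/2 < s) :
    IntegrableOn (fun t : ℝ => ((Real.sin t ^ (2 * s - 2) : ℝ) : ℂ)) (Set.Ioo 0 Real.pi) := by
  have hu : 0 < (((s - 1/2 : ℝ) : ℂ)).re := by rw [ofReal_re]; linarith
  have h := betaIntegral_convergent hu hu
  rw [intervalIntegrable_iff_integrableOn_Ioo_of_le zero_le_one, ← sub_image,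
    integrableOn_image_iff_integrableOn_abs_deriv_smul measurableSet_Ioo
      (fun t _ => sub_deriv t _) sub_inj,
    integrableOn_congr_fun (fun t ht => sub_integrand s t ht) measurableSet_Ioo] at h
  have h2 := h.const_mul ((((4 : ℝ) ^ (1 - s) : ℝ) : ℂ)⁻¹)
  refine h2.congr (Filter.Eventually.of_forall fun t => ?_)
  have : ((((4 : ℝ) ^ (1 - s) : ℝ) : ℂ)) ≠ 0 := by
    rw [ofReal_ne_zero]; positivity
  simp only
  rw [inv_mul_cancel_left₀ this]

lemma base_val (s : ℝ) (hs : 1/2 < s) :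
    ∫ t in Set.Ioo 0 Real.pi, ((Real.sin t ^ (2 * s - 2) : ℝ) : ℂ) =
    (((4 : ℝ) ^ (1 - s) * Real.pi * Real.Gamma (2 * s - 1) /
      (Real.Gamma s * Real.Gamma s) : ℝ) : ℂ) := by
  have hu : 0 < (((s - 1/2 : ℝ) : ℂ)).re := by rw [ofReal_re]; linarith
  have h := betaIntegral_eq_Gamma_mul_div _ _ hu hu
  rw [betaIntegral, intervalIntegral.integral_of_le zero_le_one, integral_Ioc_eq_integral_Ioo,
    ← sub_image, integral_image_eq_integral_abs_deriv_smul measurableSet_Ioo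
      (fun t _ => sub_deriv t _) sub_inj,
    setIntegral_congr_fun measurableSet_Ioo (fun t ht => sub_integrand s t ht),
    integral_const_mul] at h
  have h4 : ((((4 : ℝ) ^ (1 - s) : ℝ) : ℂ)) ≠ 0 := by
    rw [ofReal_ne_zero]; positivity
  apply mul_left_cancel₀ h4
  rw [h, ← ofReal_add, Gamma_ofReal, Gamma_ofReal]
  norm_cast
  have hd := Real.Gamma_mul_Gamma_add_half (s - 1/2)
  rw [show s - 1/2 + 1/2 = s by ring, show 2 * (s - 1/2) = 2 * s - 1 by ring,
    show 1 - (2 * s - 1) = 2 * (1 - s) by ring, Real.rpow_mul (by norm_num),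
    show (2:ℝ)^(2:ℝ) = 4 by norm_num] at hd
  rw [show s - 1/2 + (s - 1/2) = 2 * s - 1 by ring]
  have g1 := Real.Gamma_pos_of_pos (show 0 < s by linarith)
  have g2 := Real.Gamma_pos_of_pos (show 0 < 2 * s - 1 by linarith)
  rw [← mul_div_assoc, div_eq_div_iff g2.ne' (by positivity)]
  calc _ = (Real.Gamma (s - 1/2) * Real.Gamma s) ^ 2 := by ring
    _ = _ := by
      rw [hd, mul_pow, Real.sq_sqrt Real.pi_pos.le]; ring

lemma exp_int (s : ℝ) (hs : 1/2 < s) (k : ℂ) :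
    IntegrableOn (fun t : ℝ => exp (k * t) * ((Real.sin t ^ (2 * s - 2) : ℝ) : ℂ))
      (Set.Ioo 0 Real.pi) := by
  have h := base_int s hs
  rw [← integrableOn_Icc_iff_integrableOn_Ioo] at h ⊢
  exact h.continuousOn_mul (by fun_prop) isCompact_Icc

lemma rec_C (s : ℝ) (hs : 1/2 < s) (k : ℤ) :
    (s - 1 - k : ℂ) * (∫ t in Set.Ioo 0 Real.pi,
      exp (2 * k * I * t) * ((Real.sin t ^ (2 * s - 2) : ℝ) : ℂ)) +
    (s + k : ℂ) * (∫ t in Set.Ioo 0 Real.pi,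
      exp (2 * (k + 1 : ℤ) * I * t) * ((Real.sin t ^ (2 * s - 2) : ℝ) : ℂ)) = 0 := by
  have i1 := exp_int s hs (2 * k * I)
  have i2 := exp_int s hs (2 * (k + 1 : ℤ) * I)
  rw [← integral_const_mul, ← integral_const_mul,
    ← integral_add (i1.const_mul _) (i2.const_mul _)]
  have j := (i1.const_mul (s - 1 - k : ℂ)).add (i2.const_mul (s + k : ℂ))
  have hp := Real.pi_pos.le
  have key := intervalIntegral.integral_eq_sub_of_hasDerivAt_of_le (a := 0) (b := Real.pi) hp
    (f := fun t : ℝ => exp ((2 * k + 1) * I * t) * ((Real.sin t ^ (2 * s - 1) : ℝ) : ℂ))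
    (f' := fun t : ℝ => (s - 1 - k : ℂ) * (exp (2 * k * I * t) * ((Real.sin t ^ (2 * s - 2) : ℝ) : ℂ)) +
      (s + k : ℂ) * (exp (2 * (k + 1 : ℤ) * I * t) * ((Real.sin t ^ (2 * s - 2) : ℝ) : ℂ)))
    ?_ ?_ ?_
  · rw [intervalIntegral.integral_of_le hp, integral_Ioc_eq_integral_Ioo] at key
    rw [key]
    have : 2 * s - 1 ≠ 0 := by linarith
    simp [Real.zero_rpow this]
  · apply Continuous.continuousOn
    apply Continuous.mul (by fun_prop)
    exact continuous_ofReal.comp (Real.continuous_sin.rpow_const (fun t => Or.inr (by linarith)))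
  · intro t ht
    have hsin := Real.sin_pos_of_mem_Ioo ht
    have d1 : HasDerivAt (fun t : ℝ => exp ((2 * k + 1) * I * t))
        (exp ((2 * k + 1) * I * t) * ((2 * k + 1) * I)) t := by
      have := ((hasDerivAt_id (t : ℂ)).const_mul ((2 * k + 1) * I)).cexp.comp_ofReal
      simpa using this
    have d2 := ((Real.hasDerivAt_sin t).rpow_const (p := 2 * s - 1) (Or.inl hsin.ne')).ofReal_comp
    refine (d1.mul d2).congr_deriv ?_
    symm
    rw [show 2 * s - 1 - 1 = 2 * s - 2 by ring,
      show Real.sin t ^ (2 * s - 1) = Real.sin t * Real.sin t ^ (2 * s - 2) by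
        rw [show 2 * s - 1 = 1 + (2 * s - 2) by ring, Real.rpow_add hsin, Real.rpow_one]]
    push_cast
    have E1 : exp (2 * k * I * t) = exp ((2 * k + 1) * I * t) * (cos t - I * sin t) := by
      have : cos (t:ℂ) - I * sin t = exp (-t * I) := by
        rw [exp_mul_I, cos_neg, sin_neg]; ring
      rw [this, ← exp_add]; congr 1; ring
    have E2 : exp (2 * (k + 1) * I * t) = exp ((2 * k + 1) * I * t) * (cos t + I * sin t) := by
      have : cos (t:ℂ) + I * sin t = exp (t * I) := by
        rw [exp_mul_I]; ring
      rw [this, ← exp_add]; congr 1; ring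
    rw [E1, E2]
    ring
  · rw [intervalIntegrable_iff_integrableOn_Ioo_of_le hp]
    exact j

lemma val_C (s : ℝ) (hs : 1/2 < s) (hs1 : s < 1) (k : ℤ) :
    ∫ t in Set.Ioo 0 Real.pi, exp (2 * k * I * t) * ((Real.sin t ^ (2 * s - 2) : ℝ) : ℂ) =
    (((4 : ℝ) ^ (1 - s) * Real.pi : ℝ) : ℂ) * (-1 : ℂ) ^ k *
          ((Real.Gamma (2 * s - 1) / (Real.Gamma (s - k) * Real.Gamma (s + k)) : ℝ) : ℂ) := by
  have ne1 : ∀ j : ℤ, s + j ≠ 0 := by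
    intro j h
    have h1 : (-1:ℝ) < j := by linarith
    have h2 : (j:ℝ) < 0 := by linarith
    have h1' : (-1:ℤ) < j := by exact_mod_cast h1
    have h2' : j < 0 := by exact_mod_cast h2
    omega
  have gne : ∀ j : ℤ, Real.Gamma (s + j) ≠ 0 := by
    intro j
    refine Real.Gamma_ne_zero fun m h => ne1 (j + m) ?_
    push_cast; linarith
  have step : ∀ j : ℤ, (s - 1 - j : ℂ) * ((((4 : ℝ) ^ (1 - s) * Real.pi : ℝ) : ℂ) * (-1 : ℂ) ^ j *
      ((Real.Gamma (2 * s - 1) / (Real.Gamma (s - j) * Real.Gamma (s + j)) : ℝ) : ℂ)) +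
      (s + j : ℂ) * ((((4 : ℝ) ^ (1 - s) * Real.pi : ℝ) : ℂ) * (-1 : ℂ) ^ (j + 1) *
      ((Real.Gamma (2 * s - 1) / (Real.Gamma (s - (j + 1 : ℤ)) * Real.Gamma (s + (j + 1 : ℤ))) : ℝ) : ℂ))
      = 0 := by
    intro j
    have a1 : Real.Gamma (s + (j + 1 : ℤ)) = (s + j) * Real.Gamma (s + j) := by
      rw [← Real.Gamma_add_one (ne1 j)]; congr 1; push_cast; ring
    have n2 : s - (j + 1 : ℤ) ≠ 0 := by
      have := ne1 (-(j + 1)); push_cast at this ⊢; rwa [sub_eq_add_neg]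
    have a2 : Real.Gamma (s - j) = (s - (j + 1 : ℤ)) * Real.Gamma (s - (j + 1 : ℤ)) := by
      rw [← Real.Gamma_add_one n2]; congr 1; push_cast; ring
    have n3 : Real.Gamma (s - (j + 1 : ℤ)) ≠ 0 := by
      have := gne (-(j + 1)); push_cast at this ⊢; rwa [sub_eq_add_neg]
    rw [a1, a2, zpow_add_one₀ (by norm_num)]
    have n4 := ne1 j
    have n5 := gne j
    have main : (s - 1 - j) * (Real.Gamma (2 * s - 1) / ((s - (j + 1 : ℤ)) * Real.Gamma (s - (j + 1 : ℤ)) * Real.Gamma (s + j)))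
      = (s + j) * (Real.Gamma (2 * s - 1) / (Real.Gamma (s - (j + 1 : ℤ)) * ((s + j) * Real.Gamma (s + j)))) := by
      have : s - 1 - j = s - (j + 1 : ℤ) := by push_cast; ring
      rw [this]
      field_simp
    have main' := congrArg (fun r : ℝ => (r : ℂ)) main
    simp only [ofReal_mul (s - 1 - j), ofReal_mul (s + j) (_ / _)] at main'
    push_cast at main' ⊢
    linear_combination (((4 : ℝ) ^ (1 - s) : ℝ) : ℂ) * Real.pi * (-1 : ℂ) ^ j * main'
  have c1 : ∀ j : ℤ, (s + j : ℂ) ≠ 0 := by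
    intro j; have := ne1 j; exact_mod_cast this
  have c2 : ∀ j : ℤ, (s - 1 - j : ℂ) ≠ 0 := by
    intro j; have := c1 (-1 - j); push_cast at this
    intro h; apply this; rw [← h]; ring
  induction k using Int.induction_on with
  | zero =>
    have := base_val s hs
    simp only [Int.cast_zero, mul_zero, zero_mul, exp_zero, one_mul, zpow_zero, mul_one, sub_zero,
      add_zero]
    rw [this]; push_cast; ring
  | succ n ih =>
    have h1 := rec_C s hs n
    have h2 := step n
    rw [ih] at h1
    exact mul_left_cancel₀ (c1 n) (by linear_combination h1 - h2)
  | pred n ih =>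
    have h1 := rec_C s hs (-n - 1)
    have h2 := step (-n - 1)
    rw [show (-(n:ℤ) - 1 + 1) = -n by ring] at h1 h2
    rw [ih] at h1
    exact mul_left_cancel₀ (c2 (-n - 1)) (by linear_combination h1 - h2)

lemma fac (r : ℝ) (k : ℤ) (y : ℝ) :
    ((y : ℂ) - I) ^ ((k : ℂ) - (r : ℂ)) * ((y : ℂ) + I) ^ (-(k : ℂ) - (r : ℂ)) =
    (((y : ℂ) - I) / ((y : ℂ) + I)) ^ k * (((1 + y ^ 2) ^ (-r) : ℝ) : ℂ) := by
  have h1 : (y : ℂ) - I ≠ 0 := fun h => by simpa using congrArg im h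
  have h2 : (y : ℂ) + I ≠ 0 := fun h => by simpa using congrArg im h
  have h3 : (y : ℂ) - I = (starRingEnd ℂ) ((y : ℂ) + I) := by simp [sub_eq_add_neg]
  have ha : ((y : ℂ) + I).arg ≠ Real.pi := by
    rw [Ne, arg_eq_pi_iff]; simp
  have key : ((y : ℂ) - I) ^ (-(r : ℂ)) * ((y : ℂ) + I) ^ (-(r : ℂ)) =
      (((1 + y ^ 2) ^ (-r) : ℝ) : ℂ) := by
    rw [h3, conj_cpow _ _ ha]
    rw [show (starRingEnd ℂ) (-(r:ℂ)) = ((-r : ℝ) : ℂ) by simp,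
      show (-(r:ℂ)) = ((-r : ℝ) : ℂ) by simp, mul_comm, mul_conj, normSq_eq_norm_sq,
      norm_cpow_real, ← Real.rpow_natCast, ← Real.rpow_mul (norm_nonneg _), mul_comm,
      Real.rpow_mul (norm_nonneg _), Real.rpow_natCast, ← normSq_eq_norm_sq]
    congr 2
    simp [normSq_apply]; ring
  rw [sub_eq_add_neg (k:ℂ), sub_eq_add_neg (-(k:ℂ)), cpow_add _ _ h1, cpow_add _ _ h2, ← key,
    cpow_neg _ (k:ℂ), cpow_intCast, cpow_intCast, div_zpow]
  field_simp

lemma fac_tan (r : ℝ) (k : ℤ) (t : ℝ) (ht : t ∈ Set.Ioo (-(Real.pi / 2)) (Real.pi / 2)) :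
    ((Real.tan t : ℂ) - I) ^ ((k : ℂ) - (r : ℂ)) * ((Real.tan t : ℂ) + I) ^ (-(k : ℂ) - (r : ℂ)) =
    (-1 : ℂ) ^ k * exp (2 * k * I * t) * ((Real.cos t ^ (2 * r) : ℝ) : ℂ) := by
  have hc := Real.cos_pos_of_mem_Ioo ht
  have hc' : (Real.cos t : ℂ) ≠ 0 := by exact_mod_cast hc.ne'
  rw [fac]
  congr 1
  · have h2 : (Real.tan t : ℂ) + I ≠ 0 := fun h => by simpa using congrArg im h
    have : ((Real.tan t : ℂ) - I) / ((Real.tan t : ℂ) + I) = -1 * exp (2 * I * t) := by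
      rw [div_eq_iff h2, show (2 * I * (t:ℂ)) = t * I + t * I by ring, exp_add, exp_mul_I,
        Real.tan_eq_sin_div_cos]
      push_cast at hc' ⊢
      field_simp
      have h := sin_sq_add_cos_sq (t : ℂ)
      have hI := I_sq
      generalize sin (t:ℂ) = S at *
      generalize cos (t:ℂ) = C at *
      linear_combination (-S+I*C) * h + (S*S*S+2*C*C*S+I*C*S*S) * hI
    rw [this, mul_zpow, ← exp_int_mul]
    congr 2; ring
  · congr 1
    have : 1 + Real.tan t ^ 2 = Real.cos t ^ (-2 : ℝ) := by
      rw [← inv_inv (1 + _), Real.inv_one_add_tan_sq hc.ne', Real.rpow_neg hc.le]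
      norm_num
    rw [this, ← Real.rpow_mul hc.le]
    congr 1; ring

lemma integrand_tan (s : ℝ) (k : ℤ) (t u : ℝ) (ht : t ∈ Set.Ioo (-(Real.pi / 2)) (Real.pi / 2))
    (hu : u ∈ Set.Ioo (-(Real.pi / 2)) (Real.pi / 2)) :
    |1 / Real.cos t ^ 2| • (((Real.tan t : ℂ) - I) ^ ((k : ℂ) - (s : ℂ)) *
        ((Real.tan t : ℂ) + I) ^ (-(k : ℂ) - (s : ℂ)) *
        ((|Real.tan u - Real.tan t| ^ (-2 * (1 - s)) : ℝ) : ℂ)) =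
    ((-1 : ℂ) ^ k * exp (2 * k * I * u) * ((Real.cos u ^ (2 * (1 - s)) : ℝ) : ℂ)) *
      (exp (2 * k * I * (t - u : ℝ)) * ((|Real.sin (t - u)| ^ (2 * s - 2) : ℝ) : ℂ)) := by
  have hc := Real.cos_pos_of_mem_Ioo ht
  have hd := Real.cos_pos_of_mem_Ioo hu
  rw [fac_tan _ _ _ ht]
  have e1 : exp (2 * k * I * t) = exp (2 * k * I * u) * exp (2 * k * I * (t - u : ℝ)) := by
    rw [← exp_add]; congr 1; push_cast; ring
  have e2 : |Real.tan u - Real.tan t| = |Real.sin (t - u)| / (Real.cos u * Real.cos t) := by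
    rw [abs_sub_comm, ← abs_of_pos (mul_pos hd hc), ← abs_div, Real.sin_sub,
      Real.tan_eq_sin_div_cos, Real.tan_eq_sin_div_cos]
    congr 1; field_simp
  have e3 : |1 / Real.cos t ^ 2| * (Real.cos t ^ (2 * s) * |Real.tan u - Real.tan t| ^ (-2 * (1 - s)))
      = Real.cos u ^ (2 * (1 - s)) * |Real.sin (t - u)| ^ (2 * s - 2) := by
    rw [e2, abs_of_pos (by positivity), Real.div_rpow (abs_nonneg _) (by positivity),
      Real.mul_rpow hd.le hc.le, show -2 * (1 - s) = 2 * s - 2 by ring,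
      show 2 * (1 - s) = -(2 * s - 2) by ring, Real.rpow_neg hd.le,
      Real.rpow_sub hc (2 * s) 2, Real.rpow_two]
    field_simp
  have e3' := congrArg (fun r : ℝ => (r : ℂ)) e3
  simp only [ofReal_mul] at e3'
  rw [real_smul, e1]
  linear_combination (-1 : ℂ) ^ k * exp (2 * k * I * u) * exp (2 * k * I * (t - u : ℝ)) * e3'

theorem intertwining_integral (s : ℝ) (hs : 1/2 < s) (hs1 : s < 1) (k : ℤ) (x : ℝ) :
    Integrable (fun y : ℝ =>
      ((y : ℂ) - Complex.I) ^ ((k : ℂ) - (s : ℂ)) *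
        ((y : ℂ) + Complex.I) ^ (-(k : ℂ) - (s : ℂ)) *
        ((|x - y| ^ (-2 * (1 - s)) : ℝ) : ℂ)) ∧
    ∫ y : ℝ,
        ((y : ℂ) - Complex.I) ^ ((k : ℂ) - (s : ℂ)) *
          ((y : ℂ) + Complex.I) ^ (-(k : ℂ) - (s : ℂ)) *
          ((|x - y| ^ (-2 * (1 - s)) : ℝ) : ℂ)
      = (((4 : ℝ) ^ (1 - s) * Real.pi : ℝ) : ℂ) * (-1 : ℂ) ^ k *
          ((Real.Gamma (2 * s - 1) / (Real.Gamma (s - k) * Real.Gamma (s + k)) : ℝ) : ℂ) *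
          (((x : ℂ) - Complex.I) ^ ((k : ℂ) - (1 - (s : ℂ))) *
            ((x : ℂ) + Complex.I) ^ (-(k : ℂ) - (1 - (s : ℂ)))) := by
  obtain ⟨u, hu, rfl⟩ : ∃ u ∈ Set.Ioo (-(Real.pi / 2)) (Real.pi / 2), Real.tan u = x :=
    ⟨Real.arctan x, Real.arctan_mem_Ioo x, Real.tan_arctan x⟩
  have hp := Real.pi_pos
  have hle : -(Real.pi / 2) ≤ Real.pi / 2 := by linarith
  have hder : ∀ t ∈ Set.Ioo (-(Real.pi / 2)) (Real.pi / 2),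
      HasDerivWithinAt Real.tan (1 / Real.cos t ^ 2) (Set.Ioo (-(Real.pi / 2)) (Real.pi / 2)) t :=
    fun t ht => (Real.hasDerivAt_tan (Real.cos_pos_of_mem_Ioo ht).ne').hasDerivWithinAt
  let h : ℝ → ℂ := fun t => exp (2 * k * I * t) * ((|Real.sin t| ^ (2 * s - 2) : ℝ) : ℂ)
  have hper : Function.Periodic h Real.pi := by
    intro t
    simp only [h]
    rw [Real.sin_add_pi, abs_neg]
    congr 1
    rw [show 2 * k * I * ((t + Real.pi : ℝ) : ℂ) = 2 * k * I * t + k * (2 * Real.pi * I) by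
      push_cast; ring, exp_add, exp_int_mul_two_pi_mul_I, mul_one]
  have hcongr : Set.EqOn (fun t : ℝ => exp (2 * k * I * t) * ((Real.sin t ^ (2 * s - 2) : ℝ) : ℂ))
      h (Set.Ioo 0 Real.pi) := by
    intro t ht
    simp only [h]
    rw [abs_of_pos (Real.sin_pos_of_mem_Ioo ht)]
  have hint0 : IntervalIntegrable h volume 0 Real.pi := by
    rw [intervalIntegrable_iff_integrableOn_Ioo_of_le hp.le]
    exact (exp_int s hs (2 * k * I)).congr_fun hcongr measurableSet_Ioo
  have hval0 : ∫ t in (0:ℝ)..Real.pi, h t = (((4 : ℝ) ^ (1 - s) * Real.pi : ℝ) : ℂ) * (-1 : ℂ) ^ k *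
      ((Real.Gamma (2 * s - 1) / (Real.Gamma (s - k) * Real.Gamma (s + k)) : ℝ) : ℂ) := by
    rw [intervalIntegral.integral_of_le hp.le, integral_Ioc_eq_integral_Ioo,
      ← setIntegral_congr_fun measurableSet_Ioo hcongr]
    exact val_C s hs hs1 k
  have hint1 : IntervalIntegrable (fun t => h (t - u)) volume (-(Real.pi / 2)) (Real.pi / 2) := by
    have := (hper.intervalIntegrable₀ hp.ne' hint0 (-(Real.pi / 2) - u) (Real.pi / 2 - u)).comp_sub_right u
    simpa using this
  have hval1 : ∫ t in (-(Real.pi / 2))..(Real.pi / 2), h (t - u) = ∫ t in (0:ℝ)..Real.pi, h t := by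
    rw [intervalIntegral.integral_comp_sub_right]
    have := hper.intervalIntegral_add_eq (-(Real.pi / 2) - u) 0
    rw [zero_add] at this
    rw [← this]; congr 1; ring
  constructor
  · rw [← integrableOn_univ, ← Real.image_tan_Ioo,
      integrableOn_image_iff_integrableOn_abs_deriv_smul measurableSet_Ioo hder Real.injOn_tan,
      integrableOn_congr_fun (fun t ht => integrand_tan s k t u ht hu) measurableSet_Ioo]
    rw [intervalIntegrable_iff_integrableOn_Ioo_of_le hle] at hint1
    exact hint1.const_mul _
  · rw [← setIntegral_univ, ← Real.image_tan_Ioo,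
      integral_image_eq_integral_abs_deriv_smul measurableSet_Ioo hder Real.injOn_tan,
      setIntegral_congr_fun measurableSet_Ioo (fun t ht => integrand_tan s k t u ht hu),
      integral_const_mul]
    rw [intervalIntegral.integral_of_le hle, integral_Ioc_eq_integral_Ioo, hval0] at hval1
    simp only [h] at hval1
    rw [hval1]
    have := fac_tan (1 - s) k u hu
    rw [show ((1 - s : ℝ) : ℂ) = 1 - (s : ℂ) by push_cast; rfl] at this
    rw [this]
    ring
end

section
/- Let s ∈ ℝ with 1/2 < s < 1 and let k ∈ ℤ. Then ∫_ℝ (x − i)^{k − s}·(x + i)^{−k − s} · conj( ∫_ℝ (y − i)^{k − s}·(y + i)^{−k − s}·|x − y|^{−2(1−s)} dy ) dx = 4^{1−s}·π²·(−1)^k·Γ(2s − 1)/(Γ(s − k)·Γ(s + k)), and this quantity is a positive real number. -/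
open Complex MeasureTheory


lemma cs_tan_log_add (t : ℝ) (ht : t ∈ Set.Ioo (-(Real.pi/2)) (Real.pi/2)) :
    Complex.log ((Real.tan t : ℂ) + I) = ((-Real.log (Real.cos t) : ℝ) : ℂ) + ((Real.pi/2 - t : ℝ):ℂ) * I := by
  have hc : 0 < Real.cos t := Real.cos_pos_of_mem_Ioo ht
  have hc' : (Complex.cos t) ≠ 0 := by rw [← ofReal_cos]; exact_mod_cast hc.ne'
  have h : ((Real.tan t : ℂ) + I) = (((Real.cos t)⁻¹ : ℝ) : ℂ) * cexp (((Real.pi/2 - t : ℝ):ℂ) * I) := by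
    rw [Complex.exp_mul_I, ← ofReal_cos, ← ofReal_sin, Real.cos_pi_div_two_sub, Real.sin_pi_div_two_sub,
      Real.tan_eq_sin_div_cos]
    push_cast
    field_simp
  rw [h, Complex.log_ofReal_mul (inv_pos.2 hc) (Complex.exp_ne_zero _), Real.log_inv,
    Complex.log_exp]
  · simp; linarith [ht.1, ht.2, Real.pi_pos]
  · simp; linarith [ht.1, ht.2, Real.pi_pos]

lemma cs_tan_log_sub (t : ℝ) (ht : t ∈ Set.Ioo (-(Real.pi/2)) (Real.pi/2)) :
    Complex.log ((Real.tan t : ℂ) - I) = ((-Real.log (Real.cos t) : ℝ) : ℂ) - ((Real.pi/2 - t : ℝ):ℂ) * I := by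
  have hc : 0 < Real.cos t := Real.cos_pos_of_mem_Ioo ht
  have hc' : (Complex.cos t) ≠ 0 := by rw [← ofReal_cos]; exact_mod_cast hc.ne'
  have h : ((Real.tan t : ℂ) - I) = (((Real.cos t)⁻¹ : ℝ) : ℂ) * cexp (((-(Real.pi/2 - t) : ℝ):ℂ) * I) := by
    rw [Complex.exp_mul_I, ← ofReal_cos, ← ofReal_sin, Real.cos_neg, Real.sin_neg, Real.cos_pi_div_two_sub, Real.sin_pi_div_two_sub,
      Real.tan_eq_sin_div_cos]
    push_cast
    field_simp
    ring
  rw [h, Complex.log_ofReal_mul (inv_pos.2 hc) (Complex.exp_ne_zero _), Real.log_inv,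
    Complex.log_exp]
  · push_cast; ring
  · simp; linarith [ht.1, ht.2, Real.pi_pos]
  · simp; linarith [ht.1, ht.2, Real.pi_pos]

lemma cs_f_tan (s : ℝ) (k : ℤ) (t : ℝ) (ht : t ∈ Set.Ioo (-(Real.pi/2)) (Real.pi/2)) :
    ((Real.tan t : ℂ) - I) ^ ((k : ℂ) - (s : ℂ)) * ((Real.tan t : ℂ) + I) ^ (-(k : ℂ) - (s : ℂ))
      = ((Real.cos t ^ (2*s) : ℝ) : ℂ) * cexp (2 * k * (t - Real.pi/2) * I) := by
  have hc : 0 < Real.cos t := Real.cos_pos_of_mem_Ioo ht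
  have h1 : ((Real.tan t : ℂ) - I) ≠ 0 := by
    intro h; have := congrArg Complex.im h; simp [-ofReal_tan] at this
  have h2 : ((Real.tan t : ℂ) + I) ≠ 0 := by
    intro h; have := congrArg Complex.im h; simp [-ofReal_tan] at this
  rw [Complex.cpow_def_of_ne_zero h1, Complex.cpow_def_of_ne_zero h2, cs_tan_log_add t ht, cs_tan_log_sub t ht,
    Real.rpow_def_of_pos hc, ofReal_exp, ← Complex.exp_add, ← Complex.exp_add]
  congr 1
  push_cast
  ring

lemma cs_inner (s : ℝ) (k : ℤ) (t : ℝ) (ht : t ∈ Set.Ioo (-(Real.pi/2)) (Real.pi/2)) :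
    (∫ y : ℝ, ((y : ℂ) - I) ^ ((k : ℂ) - (s : ℂ)) * ((y : ℂ) + I) ^ (-(k : ℂ) - (s : ℂ)) *
                ((|Real.tan t - y| ^ (-2 * (1 - s)) : ℝ) : ℂ))
    = ((Real.cos t ^ (2 - 2*s) : ℝ) : ℂ) * cexp (2 * k * (t - Real.pi/2) * I) *
      ∫ u in (0:ℝ)..Real.pi, ((|Real.sin u| ^ (2*s-2) : ℝ) : ℂ) * cexp (2 * k * u * I) := by
  have hc : 0 < Real.cos t := Real.cos_pos_of_mem_Ioo ht
  set g : ℝ → ℂ := fun u => ((|Real.sin u| ^ (2*s-2) : ℝ) : ℂ) * cexp (2 * k * u * I) with hg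
  have hper : Function.Periodic g Real.pi := by
    intro u
    simp only [hg, Real.sin_add_pi, abs_neg]
    congr 1
    rw [show (2 * k * ((u + Real.pi : ℝ):ℂ) * I) = 2 * k * u * I + k * (2 * Real.pi * I) by push_cast; ring,
      Complex.exp_add, Complex.exp_int_mul_two_pi_mul_I, mul_one]
  rw [← setIntegral_univ, ← Real.image_tan_Ioo,
    integral_image_eq_integral_abs_deriv_smul measurableSet_Ioo
      (fun u hu => (Real.hasDerivAt_tan_of_mem_Ioo hu).hasDerivWithinAt) Real.injOn_tan]
  have h1 : ∫ u in (0:ℝ)..Real.pi, g u = ∫ u in Set.Ioo (-(Real.pi/2)) (Real.pi/2), g (u - t) := by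
    rw [← integral_Ioc_eq_integral_Ioo, ← intervalIntegral.integral_of_le (by linarith [Real.pi_pos]),
      intervalIntegral.integral_comp_sub_right]
    have := hper.intervalIntegral_add_eq 0 (-(Real.pi/2) - t)
    rw [zero_add] at this
    rw [this]
    congr 1
    ring
  rw [h1, ← integral_const_mul]
  refine setIntegral_congr_fun measurableSet_Ioo fun u hu => ?_
  have hcu : 0 < Real.cos u := Real.cos_pos_of_mem_Ioo hu
  beta_reduce
  rw [cs_f_tan s k u hu]
  have h2 : |Real.tan t - Real.tan u| = |Real.sin (u - t)| / (Real.cos t * Real.cos u) := by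
    rw [← abs_of_pos (mul_pos hc hcu), ← abs_div, ← abs_neg (Real.sin (u - t) / _)]
    congr 1
    rw [Real.tan_eq_sin_div_cos, Real.tan_eq_sin_div_cos, Real.sin_sub]
    field_simp
    ring
  have h3 : |1 / Real.cos u ^ 2| * (Real.cos u ^ (2*s) * |Real.tan t - Real.tan u| ^ (-2 * (1 - s)))
     = Real.cos t ^ (2 - 2*s) * |Real.sin (u - t)| ^ (2*s-2) := by
    rw [h2, Real.div_rpow (abs_nonneg _) (by positivity), Real.mul_rpow hc.le hcu.le, abs_of_pos (by positivity),
      show -2 * (1-s) = 2*s-2 by ring, show 2-2*s = -(2*s-2) by ring, Real.rpow_neg hc.le,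
      Real.rpow_sub hcu, Real.rpow_two]
    have := Real.rpow_pos_of_pos hcu (2*s)
    have := Real.rpow_pos_of_pos hc (2*s-2)
    field_simp
  have h3' := congrArg (fun r : ℝ => (r : ℂ)) h3
  have h4 : cexp (2 * k * (u - Real.pi/2) * I) = cexp (2 * k * (t - Real.pi/2) * I) * cexp (2 * k * ((u - t : ℝ) : ℂ) * I) := by
    rw [← Complex.exp_add]; congr 1; push_cast; ring
  rw [h4, real_smul]
  simp only [hg]
  simp only [ofReal_mul] at h3'
  linear_combination cexp (2 * k * (t - Real.pi/2) * I) * cexp (2 * k * ((u - t : ℝ) : ℂ) * I) * h3'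

noncomputable def csR (s : ℝ) (k : ℤ) : ℝ :=
  (4 : ℝ) ^ (1 - s) * Real.pi * (-1 : ℝ) ^ k * Real.Gamma (2 * s - 1) /
          (Real.Gamma (s - k) * Real.Gamma (s + k))

lemma cs_not_int (s : ℝ) (hs : 1/2 < s) (hs1 : s < 1) (m : ℤ) : s ≠ m := by
  rintro rfl
  have h1 : (0:ℝ) < m := by linarith
  have h2 : 0 < m := by exact_mod_cast h1
  have h3 : m < 1 := by exact_mod_cast hs1
  omega

lemma csR_rec (s : ℝ) (hs : 1/2 < s) (hs1 : s < 1) (k : ℤ) :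
    (s + k) * csR s (k+1) = (k + 1 - s) * csR s k := by
  have h1 : s + k ≠ 0 := fun h => cs_not_int s hs hs1 (-k) (by push_cast; linarith)
  have h2 : s - k - 1 ≠ 0 := fun h => cs_not_int s hs hs1 (k+1) (by push_cast; linarith)
  have g1 : Real.Gamma (s + (k+1 : ℤ)) = (s+k) * Real.Gamma (s+k) := by
    rw [← Real.Gamma_add_one h1]; push_cast; ring_nf
  have g2 : Real.Gamma (s - k) = (s - k - 1) * Real.Gamma (s-(k+1 : ℤ)) := by
    have := Real.Gamma_add_one h2
    rw [sub_add_cancel] at this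
    rw [this]; push_cast; ring_nf
  have n1 : Real.Gamma (s+k) ≠ 0 := by
    apply Real.Gamma_ne_zero
    intro m h; exact cs_not_int s hs hs1 (-m-k) (by push_cast; linarith)
  have n2 : Real.Gamma (s-(k+1 : ℤ)) ≠ 0 := by
    apply Real.Gamma_ne_zero
    intro m h; exact cs_not_int s hs hs1 (-m+(k+1)) (by push_cast at *; linarith)
  unfold csR
  rw [g1, g2, zpow_add_one₀ (by norm_num)]
  field_simp
  ring

lemma csR_pos (s : ℝ) (hs : 1/2 < s) (hs1 : s < 1) (k : ℤ) : 0 < csR s k := by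
  have key : ∀ k : ℤ, (0 < csR s (k+1) ↔ 0 < csR s k) := by
    intro k
    have h := csR_rec s hs hs1 k
    rcases le_or_gt 0 k with hk | hk
    · have hk' : (0:ℝ) ≤ k := by exact_mod_cast hk
      have a : 0 < s + k := by linarith
      have b : 0 < k + 1 - s := by linarith
      rw [← mul_pos_iff_of_pos_left a, h, mul_pos_iff_of_pos_left b]
    · have hk' : (k:ℝ) ≤ -1 := by exact_mod_cast (by omega : k ≤ -1)
      have a : 0 < -(s + k) := by linarith
      have b : 0 < -(k + 1 - s) := by linarith
      rw [← mul_pos_iff_of_pos_left a, neg_mul, h, ← neg_mul, mul_pos_iff_of_pos_left b]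
  induction k using Int.induction_on with
  | zero =>
    unfold csR
    have := Real.Gamma_pos_of_pos (show 0 < s by linarith)
    have := Real.Gamma_pos_of_pos (show 0 < 2*s-1 by linarith)
    simp
    positivity
  | succ i ih => exact (key i).2 ih
  | pred i ih => exact (key _).1 (by simpa using ih)

lemma cs_beta (s : ℝ) (hs : 1/2 < s) :
    IntegrableOn (fun u : ℝ => ((Real.sin u ^ (2*s-2) : ℝ) : ℂ)) (Set.Ioo 0 Real.pi) ∧
    Complex.betaIntegral ((s - 1/2 : ℝ):ℂ) ((s - 1/2 : ℝ):ℂ) =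
      ((2 ^ (2 - 2*s) : ℝ):ℂ) * ∫ u in Set.Ioo 0 Real.pi, ((Real.sin u ^ (2*s-2) : ℝ) : ℂ) := by
  set a : ℝ := s - 1/2 with ha
  have ha0 : 0 < a := by linarith
  set G : ℝ → ℂ := fun x => (x : ℂ) ^ ((a:ℂ) - 1) * (1 - (x : ℂ)) ^ ((a:ℂ) - 1) with hG
  set φ : ℝ → ℝ := fun u => (1 + Real.cos u)/2 with hφ
  have him : φ '' Set.Ioo 0 Real.pi = Set.Ioo 0 1 := by
    ext x
    constructor
    · rintro ⟨u, hu, rfl⟩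
      have h1 : Real.cos u < 1 := by
        rw [← Real.cos_zero]
        exact Real.cos_lt_cos_of_nonneg_of_le_pi le_rfl hu.2.le hu.1
      have h2 : -1 < Real.cos u := by
        rw [← Real.cos_pi]
        exact Real.cos_lt_cos_of_nonneg_of_le_pi hu.1.le le_rfl hu.2
      simp only [hφ, Set.mem_Ioo]
      constructor <;> linarith
    · rintro ⟨h0, h1⟩
      refine ⟨Real.arccos (2*x-1), ⟨Real.arccos_pos.2 (by linarith), ?_⟩, ?_⟩
      · refine lt_of_le_of_ne (Real.arccos_le_pi _) fun h => ?_
        have := Real.arccos_eq_pi.1 h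
        linarith
      · simp only [hφ]
        rw [Real.cos_arccos (by linarith) (by linarith)]; ring
  have hinj : Set.InjOn φ (Set.Ioo 0 Real.pi) := by
    intro x hx y hy h
    apply Real.injOn_cos ⟨hx.1.le, hx.2.le⟩ ⟨hy.1.le, hy.2.le⟩
    simp only [hφ] at h
    linarith
  have hd : ∀ u ∈ Set.Ioo 0 Real.pi, HasDerivWithinAt φ (-Real.sin u / 2) (Set.Ioo 0 Real.pi) u := by
    intro u _
    exact (((Real.hasDerivAt_cos u).const_add 1).div_const 2).hasDerivWithinAt
  have hpt : ∀ u ∈ Set.Ioo 0 Real.pi, |-Real.sin u / 2| • G (φ u) =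
      ((2 ^ (2 - 2*s) : ℝ):ℂ) * ((Real.sin u ^ (2*s-2) : ℝ) : ℂ) := by
    intro u hu
    have hsin : 0 < Real.sin u := Real.sin_pos_of_mem_Ioo hu
    have hm : φ u ∈ Set.Ioo (0:ℝ) 1 := him ▸ Set.mem_image_of_mem φ hu
    have e1 : ((a:ℂ) - 1) = ((a - 1 : ℝ) : ℂ) := by push_cast; rfl
    have e2 : (1 - ((φ u : ℝ) : ℂ)) = ((1 - φ u : ℝ) : ℂ) := by push_cast; rfl
    simp only [hG]
    rw [e1, e2, ← ofReal_cpow hm.1.le, ← ofReal_cpow (by linarith [hm.2]), real_smul, ← ofReal_mul, ← ofReal_mul,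
      ← ofReal_mul, ← Real.mul_rpow hm.1.le (by linarith [hm.2])]
    congr 1
    have e3 : φ u * (1 - φ u) = (Real.sin u / 2)^(2:ℝ) := by
      simp only [hφ, Real.rpow_two]
      nlinarith [Real.sin_sq_add_cos_sq u]
    rw [e3, neg_div, abs_neg, abs_of_pos (by positivity), ← Real.rpow_mul (by positivity)]
    nth_rewrite 1 [← Real.rpow_one (Real.sin u / 2)]
    rw [← Real.rpow_add (by positivity), Real.div_rpow hsin.le (by norm_num),
      show 1 + 2 * (a - 1) = 2*s-2 by rw [ha]; ring, show 2 - 2*s = -(2*s-2) by ring, Real.rpow_neg (by norm_num)]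
    field_simp
  have hconv := Complex.betaIntegral_convergent (u := (a:ℂ)) (v := (a:ℂ)) (by simpa using ha0) (by simpa using ha0)
  rw [intervalIntegrable_iff_integrableOn_Ioo_of_le zero_le_one, ← him,
    integrableOn_image_iff_integrableOn_abs_deriv_smul measurableSet_Ioo hd hinj] at hconv
  have h2 : ((2 ^ (2 - 2*s) : ℝ):ℂ) ≠ 0 := by
    exact_mod_cast (Real.rpow_pos_of_pos (by norm_num) _).ne'
  constructor
  · have := (integrableOn_congr_fun hpt measurableSet_Ioo).1 hconv
    have := this.const_mul (((2 ^ (2 - 2*s) : ℝ):ℂ))⁻¹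
    simp only [inv_mul_cancel_left₀ h2] at this
    exact this
  · rw [Complex.betaIntegral, intervalIntegral.integral_of_le zero_le_one, integral_Ioc_eq_integral_Ioo, ← him,
      integral_image_eq_integral_abs_deriv_smul measurableSet_Ioo hd hinj, ← integral_const_mul]
    exact setIntegral_congr_fun measurableSet_Ioo hpt

lemma cs_C0 (s : ℝ) (hs : 1/2 < s) :
    ∫ u in Set.Ioo 0 Real.pi, ((Real.sin u ^ (2*s-2) : ℝ) : ℂ) = (csR s 0 : ℂ) := by
  have hb := (cs_beta s hs).2
  have ha0 : 0 < s - 1/2 := by linarith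
  have hg := Complex.Gamma_mul_Gamma_eq_betaIntegral (s := ((s-1/2 : ℝ):ℂ)) (t := ((s-1/2 : ℝ):ℂ)) 
    (by simpa using ha0) (by simpa using ha0)
  rw [hb, ← ofReal_add, Complex.Gamma_ofReal, Complex.Gamma_ofReal, integral_complex_ofReal,
    ← ofReal_mul, ← ofReal_mul, ← ofReal_mul, ofReal_inj,
    show s - 1/2 + (s - 1/2) = 2*s-1 by ring] at hg
  have hdup := Real.Gamma_mul_Gamma_add_half (s-1/2)
  rw [show s - 1/2 + 1/2 = s by ring, show 2*(s-1/2) = 2*s-1 by ring, show 1 - (2*s-1) = 2-2*s by ring] at hdup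
  rw [integral_complex_ofReal, ofReal_inj]
  have p1 := Real.Gamma_pos_of_pos (show 0 < s by linarith)
  have p2 := Real.Gamma_pos_of_pos (show 0 < 2*s-1 by linarith)
  have h4 : (4:ℝ)^(1-s) = 2^(2-2*s) := by
    rw [show (4:ℝ) = 2^(2:ℝ) by norm_num, ← Real.rpow_mul (by norm_num)]; ring_nf
  have p3 : (0:ℝ) < 2^(2-2*s) := Real.rpow_pos_of_pos (by norm_num) _
  have hpi := Real.sq_sqrt Real.pi_pos.le
  unfold csR
  rw [h4]
  simp only [zpow_zero, Int.cast_zero, sub_zero, add_zero]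
  set J := ∫ u in Set.Ioo 0 Real.pi, Real.sin u ^ (2*s-2)
  set A := Real.Gamma (s-1/2)
  set B := Real.Gamma s
  set D := Real.Gamma (2*s-1)
  set T := (2:ℝ)^(2-2*s)
  rw [eq_div_iff (by positivity)]
  have hne : D * T ≠ 0 := by positivity
  apply mul_left_cancel₀ hne
  have : A*B*(A*B) = D*T*√Real.pi*(D*T*√Real.pi) := by rw [hdup]
  linear_combination this - B^2 * hg + D^2*T^2*hpi

lemma cs_int (s : ℝ) (hs : 1/2 < s) (k : ℤ) :
    IntervalIntegrable (fun u : ℝ => ((Real.sin u ^ (2*s-2) : ℝ) : ℂ) * cexp (2 * k * u * I)) volume 0 Real.pi := by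
  have h : IntervalIntegrable (fun u : ℝ => ((Real.sin u ^ (2*s-2) : ℝ) : ℂ)) volume 0 Real.pi := by
    rw [intervalIntegrable_iff_integrableOn_Ioo_of_le Real.pi_pos.le]
    exact (cs_beta s hs).1
  exact h.mul_continuousOn (by fun_prop)

lemma cs_rec (s : ℝ) (hs : 1/2 < s) (k : ℤ) :
    ((s:ℂ) + k) * (∫ u in (0:ℝ)..Real.pi, ((Real.sin u ^ (2*s-2) : ℝ) : ℂ) * cexp (2 * (k+1 : ℤ) * u * I))
     = (k + 1 - s) * ∫ u in (0:ℝ)..Real.pi, ((Real.sin u ^ (2*s-2) : ℝ) : ℂ) * cexp (2 * k * u * I) := by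
  have hI := ((cs_int s hs (k+1)).const_mul ((s:ℂ)+k)).sub ((cs_int s hs k).const_mul ((k:ℂ)+1-s))
  have := intervalIntegral.integral_eq_sub_of_hasDerivAt_of_le Real.pi_pos.le
    (f := fun u : ℝ => ((Real.sin u ^ (2*s-1) : ℝ) : ℂ) * cexp ((2 * k + 1) * u * I)) ?_ ?_ hI
  · rw [intervalIntegral.integral_sub ((cs_int s hs (k+1)).const_mul ((s:ℂ)+k)) ((cs_int s hs k).const_mul ((k:ℂ)+1-s)),
      intervalIntegral.integral_const_mul, intervalIntegral.integral_const_mul] at this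
    have h0 : (0:ℝ)^(2*s-1) = 0 := Real.zero_rpow (by linarith)
    simp only [Real.sin_pi, Real.sin_zero, h0, ofReal_zero, zero_mul, sub_zero] at this
    exact sub_eq_zero.1 this
  · apply Continuous.continuousOn
    have : Continuous fun u : ℝ => Real.sin u ^ (2*s-1) := 
      Real.continuous_sin.rpow_const (fun _ => Or.inr (by linarith))
    fun_prop
  · intro u hu
    have hsin : 0 < Real.sin u := Real.sin_pos_of_mem_Ioo hu
    have d1 := ((Real.hasDerivAt_sin u).rpow_const (p := 2*s-1) (Or.inl hsin.ne')).ofReal_comp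
    have d2 : HasDerivAt (fun u : ℝ => cexp ((2 * k + 1) * u * I)) (cexp ((2 * k + 1) * u * I) * ((2*k+1) * 1 * I)) u :=
      (((Complex.ofRealCLM.hasDerivAt (x := u)).const_mul (2 * (k:ℂ) + 1)).mul_const I).cexp
    convert! d1.mul d2 using 1
    have e1 : Real.sin u ^ (2*s-1) = Real.sin u ^ (2*s-2) * Real.sin u := by
      rw [← Real.rpow_add_one hsin.ne']; ring_nf
    rw [e1, show 2*s-1-1 = 2*s-2 by ring]
    have x1 : cexp (2 * (k+1:ℤ) * u * I) = cexp ((2*k+1)*u*I) * cexp (u * I) := by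
      rw [← Complex.exp_add]; congr 1; push_cast; ring
    have x2 : cexp (2 * k * u * I) = cexp ((2*k+1)*u*I) * cexp (-u * I) := by
      rw [← Complex.exp_add]; congr 1; ring
    rw [x1, x2, Complex.exp_mul_I (u:ℂ), Complex.exp_mul_I (-u:ℂ), Complex.cos_neg, Complex.sin_neg]
    push_cast
    ring

lemma cs_C (s : ℝ) (hs : 1/2 < s) (hs1 : s < 1) (k : ℤ) :
    (∫ u in (0:ℝ)..Real.pi, ((Real.sin u ^ (2*s-2) : ℝ) : ℂ) * cexp (2 * k * u * I)) = (csR s k : ℂ) := by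
  have hR : ∀ k : ℤ, ((s:ℂ) + k) * (csR s (k+1) : ℂ) = (k + 1 - s) * (csR s k : ℂ) := by
    intro k; exact_mod_cast csR_rec s hs hs1 k
  have n1 : ∀ k : ℤ, (s:ℂ) + k ≠ 0 := by
    intro k h
    have h' : s + k = 0 := by exact_mod_cast h
    exact cs_not_int s hs hs1 (-k) (by push_cast; linarith)
  have n2 : ∀ k : ℤ, (k:ℂ) + 1 - s ≠ 0 := by
    intro k h
    have h' : (k:ℝ) + 1 - s = 0 := by exact_mod_cast h
    exact cs_not_int s hs hs1 (k+1) (by push_cast; linarith)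
  induction k using Int.induction_on with
  | zero =>
    rw [← cs_C0 s hs, intervalIntegral.integral_of_le Real.pi_pos.le, integral_Ioc_eq_integral_Ioo]
    simp
  | succ i ih =>
    apply mul_left_cancel₀ (n1 i)
    rw [cs_rec s hs, hR, ih]
  | pred i ih =>
    apply mul_left_cancel₀ (n2 (-i-1))
    rw [← cs_rec s hs, ← hR, sub_add_cancel, ih]

theorem complementary_series_norm (s : ℝ) (hs : 1/2 < s) (hs1 : s < 1) (k : ℤ) :
    (∫ x : ℝ,
        ((x : ℂ) - Complex.I) ^ ((k : ℂ) - (s : ℂ)) *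
          ((x : ℂ) + Complex.I) ^ (-(k : ℂ) - (s : ℂ)) *
          (starRingEnd ℂ)
            (∫ y : ℝ,
              ((y : ℂ) - Complex.I) ^ ((k : ℂ) - (s : ℂ)) *
                ((y : ℂ) + Complex.I) ^ (-(k : ℂ) - (s : ℂ)) *
                ((|x - y| ^ (-2 * (1 - s)) : ℝ) : ℂ)))
      = (((4 : ℝ) ^ (1 - s) * Real.pi ^ 2 * (-1 : ℝ) ^ k * Real.Gamma (2 * s - 1) /
          (Real.Gamma (s - k) * Real.Gamma (s + k)) : ℝ) : ℂ) ∧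
    0 < ((4 : ℝ) ^ (1 - s) * Real.pi ^ 2 * (-1 : ℝ) ^ k * Real.Gamma (2 * s - 1) /
          (Real.Gamma (s - k) * Real.Gamma (s + k)) : ℝ) := by
  have hR : ((4 : ℝ) ^ (1 - s) * Real.pi ^ 2 * (-1 : ℝ) ^ k * Real.Gamma (2 * s - 1) /
          (Real.Gamma (s - k) * Real.Gamma (s + k)) : ℝ) = Real.pi * csR s k := by
    unfold csR; ring
  rw [hR]
  refine ⟨?_, mul_pos Real.pi_pos (csR_pos s hs hs1 k)⟩
  have hC : (∫ u in (0:ℝ)..Real.pi, ((|Real.sin u| ^ (2*s-2) : ℝ) : ℂ) * cexp (2 * k * u * I))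
      = (csR s k : ℂ) := by
    rw [← cs_C s hs hs1 k]
    refine intervalIntegral.integral_congr fun u hu => ?_
    rw [Set.uIcc_of_le Real.pi_pos.le] at hu
    beta_reduce
    rw [abs_of_nonneg (Real.sin_nonneg_of_mem_Icc hu)]
  rw [← integral_univ_inv_one_add_sq, ← integral_mul_const, ← integral_complex_ofReal]
  refine integral_congr_ae (Filter.Eventually.of_forall fun x => ?_)
  have ht := Real.arctan_mem_Ioo x
  have h1 := cs_f_tan s k _ ht
  have h2 := cs_inner s k _ ht
  have hc := Real.cos_arctan_pos x
  have h3 := Real.cos_sq_arctan x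
  rw [Real.tan_arctan] at h1 h2
  beta_reduce
  rw [h1, h2, hC, map_mul, map_mul, conj_ofReal, conj_ofReal]
  have h4 : Real.cos (Real.arctan x) ^ (2*s) * Real.cos (Real.arctan x) ^ (2-2*s) = (1 + x^2)⁻¹ := by
    rw [← Real.rpow_add hc, show 2*s + (2-2*s) = 2 by ring, Real.rpow_two, h3, one_div]
  have h5 : cexp (2 * k * (Real.arctan x - Real.pi/2) * I) *
      (starRingEnd ℂ) (cexp (2 * k * (Real.arctan x - Real.pi/2) * I)) = 1 := by
    rw [← Complex.exp_conj, ← Complex.exp_add, ← Complex.exp_zero]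
    congr 1
    have h2' : (starRingEnd ℂ) 2 = 2 := Complex.conj_ofNat 2
    simp [-ofReal_arctan, h2']
  have h4' := congrArg (fun r : ℝ => (r : ℂ)) h4
  simp only [ofReal_mul] at h4'
  rw [ofReal_mul, ← h4']
  linear_combination ((Real.cos (Real.arctan x) ^ (2*s) : ℝ) : ℂ) * ((Real.cos (Real.arctan x) ^ (2-2*s) : ℝ) : ℂ) * (csR s k : ℂ) * h5
end

section
/- Let s ∈ ℝ with 1/2 < s < 1, let n, k ∈ ℤ with n ≥ k, let 0 ≤ r < 1, and set λ = (1 + r)/(1 − r). Then the function x ↦ λ^s·(λx − i)^{k − s}·(λx + i)^{−k − s}·conj( (x − i)^{n − 1 + s}·(x + i)^{−n − 1 + s} ) is integrable on ℝ, and ∫_ℝ λ^s·(λx − i)^{k − s}·(λx + i)^{−k − s}·conj( (x − i)^{n − 1 + s}·(x + i)^{−n − 1 + s} ) dx = ((−1)^{k+n}·π/Γ(1 + n − k)) · (Γ(s + n)/Γ(s + k)) · Φ_{2n,2k}(r). -/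
/-- The Gauss hypergeometric series `F(a, b; c; x) = Σ (a)_m (b)_m / ((c)_m m!) x^m`. -/
noncomputable def hyperF (a b c x : ℝ) : ℝ :=
  ∑' m : ℕ, ((ascPochhammer ℝ m).eval a * (ascPochhammer ℝ m).eval b /
    ((ascPochhammer ℝ m).eval c * (Nat.factorial m))) * x ^ m

/-- The sign `ε = 1` if `n ≥ k`, `ε = −1` otherwise. -/
noncomputable def eps (n k : ℤ) : ℝ := if k ≤ n then 1 else -1

/-- `Φ_{2n,2k}(r) = (1 − r²)^s r^{|n−k|} F(s − εk, s + εn; 1 + |n−k|; r²)`. -/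
noncomputable def Phi (s : ℝ) (n k : ℤ) (r : ℝ) : ℝ :=
  (1 - r ^ 2) ^ s * r ^ (n - k).natAbs *
    hyperF (s - eps n k * k) (s + eps n k * n) (1 + (n - k).natAbs) (r ^ 2)

open MeasureTheory

theorem mc_congr {f g : ℕ → ℂ} {a : ℂ} (h : HasSum f a) (e : ∀ m, g m = f m) : HasSum g a := by
  rw [funext e]; exact h

theorem mc_mul {f g : ℕ → ℂ} {a b : ℂ} (h1 : HasSum f a) (h2 : HasSum g b) (c : ℂ) :
    HasSum (fun p : ℕ × ℕ => c * (f p.1 * g p.2)) (c * (a * b)) := by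
  have n1 : Summable fun x => ‖f x‖ := h1.summable.norm
  have n2 : Summable fun x => ‖g x‖ := h2.summable.norm
  exact (h1.mul h2 (summable_mul_of_summable_norm n1 n2)).mul_left c

theorem mc_binom (a : ℝ) (z : ℂ) (hz : ‖z‖ < 1) :
    HasSum (fun m : ℕ => (((ascPochhammer ℝ m).eval a / (Nat.factorial m) : ℝ) : ℂ) * z ^ m)
      ((1 - z) ^ (-(a : ℂ))) := by
  have h := (Complex.one_div_one_sub_cpow_hasFPowerSeriesOnBall_zero (a : ℂ)).hasSum (y := z)
    (by simpa [enorm_eq_nnnorm, ← NNReal.coe_lt_coe] using hz)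
  rw [zero_add, one_div, ← Complex.cpow_neg] at h
  refine mc_congr h fun m => ?_
  have h2 := Ring.factorial_nsmul_multichoose_eq_ascPochhammer (a : ℝ) m
  rw [Ring.multichoose_eq, Polynomial.ascPochhammer_smeval_eq_eval] at h2
  have h3 : (Nat.factorial m : ℝ) ≠ 0 := by positivity
  rw [← h2]
  have h3C : (Nat.factorial m : ℂ) ≠ 0 := by exact_mod_cast h3
  simp [FormalMultilinearSeries.ofScalars, Complex.ofReal_choose]
  left
  field_simp

theorem mc_cpow (z : ℂ) (hz : z.arg ≠ Real.pi) (hz0 : z ≠ 0) (k : ℤ) (s : ℝ) :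
    z ^ ((k : ℂ) - (s : ℂ)) * (starRingEnd ℂ z) ^ (-(k : ℂ) - (s : ℂ)) =
      ((‖z‖ ^ (-2 * s) : ℝ) : ℂ) * (z / starRingEnd ℂ z) ^ k := by
  have hc : starRingEnd ℂ z ≠ 0 := by simpa using hz0
  have e1 : (k : ℂ) - s = -(s : ℂ) + k := by ring
  have e2 : -(k : ℂ) - s = -(s : ℂ) + ((-k : ℤ) : ℂ) := by push_cast; ring
  rw [e1, e2, Complex.cpow_add _ _ hz0, Complex.cpow_add _ _ hc, Complex.cpow_intCast,
    Complex.cpow_intCast, Complex.conj_cpow _ _ hz]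
  have e3 : starRingEnd ℂ (-(s:ℂ)) = -(s:ℂ) := by simp
  rw [e3]
  have e4 : z ^ (-(s:ℂ)) * starRingEnd ℂ (z ^ (-(s:ℂ))) = ((‖z‖ ^ (-2 * s) : ℝ) : ℂ) := by
    rw [Complex.mul_conj, Complex.normSq_eq_norm_sq]
    congr 1
    have : -(s:ℂ) = ((-s : ℝ) : ℂ) := by simp
    rw [this, Complex.norm_cpow_real, ← Real.rpow_natCast, ← Real.rpow_mul (norm_nonneg _)]
    congr 1; push_cast; ring
  rw [← e4, div_zpow, zpow_neg]
  ring

theorem mc_fourier (j : ℤ) :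
    ∫ x in (-(Real.pi/2))..(Real.pi/2), (Complex.exp (-2 * Complex.I * (x:ℂ))) ^ j =
      if j = 0 then (Real.pi : ℂ) else 0 := by
  split_ifs with h
  · subst h; simp; 
  · have h1 : ∀ x : ℝ, (Complex.exp (-2 * Complex.I * (x:ℂ))) ^ j =
        Complex.exp ((-2 * Complex.I * j) * (x:ℂ)) := by
      intro x; rw [← Complex.exp_int_mul]; congr 1; ring
    simp_rw [h1]
    rw [integral_exp_mul_complex (by simp [h])]
    rw [div_eq_zero_iff]; left
    rw [sub_eq_zero, Complex.exp_eq_exp_iff_exists_int]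
    exact ⟨-j, by push_cast; ring⟩

theorem mc_sum (a b : ℝ) (d : ℕ) (r : ℝ) (hr : 0 ≤ r) (hr1 : r < 1) :
    HasSum (fun m : ℕ => (-1 : ℂ) ^ d * Real.pi *
        ((((ascPochhammer ℝ m).eval a / (Nat.factorial m)) *
          ((ascPochhammer ℝ (m + d)).eval b / (Nat.factorial (m + d))) * r ^ (2 * m + d) : ℝ) : ℂ))
      (∫ x in (-(Real.pi/2))..(Real.pi/2), ((-Complex.exp (-2 * Complex.I * (x:ℂ))) ^ d *
        (1 - r * Complex.exp (-2 * Complex.I * (x:ℂ))) ^ (-(a : ℂ)) *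
        (1 - r * (Complex.exp (-2 * Complex.I * (x:ℂ)))⁻¹) ^ (-(b : ℂ)))) := by
  set A : ℕ → ℂ := fun m => (((ascPochhammer ℝ m).eval a / (Nat.factorial m) : ℝ) : ℂ) with hA
  set B : ℕ → ℂ := fun m => (((ascPochhammer ℝ m).eval b / (Nat.factorial m) : ℝ) : ℂ) with hB
  have hrn : ‖(r : ℂ)‖ < 1 := by simpa [abs_of_nonneg hr] using hr1
  have hwn : ∀ x : ℝ, ‖Complex.exp (-2 * Complex.I * (x:ℂ))‖ = 1 := by
    intro x; rw [Complex.norm_exp]; simp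
  have sA : Summable fun m => ‖A m * (r:ℂ) ^ m‖ := (mc_binom a r hrn).summable.norm
  have sB : Summable fun m => ‖B m * (r:ℂ) ^ m‖ := (mc_binom b r hrn).summable.norm
  have sAB := sA.mul_norm sB
  let F : ℕ × ℕ → ℝ → ℂ := fun p x => (-Complex.exp (-2 * Complex.I * (x:ℂ))) ^ d *
    ((A p.1 * (r * Complex.exp (-2 * Complex.I * (x:ℂ))) ^ p.1) *
      (B p.2 * (r * (Complex.exp (-2 * Complex.I * (x:ℂ)))⁻¹) ^ p.2))
  have key := intervalIntegral.hasSum_integral_of_dominated_convergence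
    (a := -(Real.pi/2)) (b := Real.pi/2) (μ := volume) (F := F)
    (f := fun x : ℝ => (-Complex.exp (-2 * Complex.I * (x:ℂ))) ^ d *
        (1 - r * Complex.exp (-2 * Complex.I * (x:ℂ))) ^ (-(a : ℂ)) *
        (1 - r * (Complex.exp (-2 * Complex.I * (x:ℂ)))⁻¹) ^ (-(b : ℂ)))
    (fun p _ => ‖(A p.1 * (r:ℂ) ^ p.1) * (B p.2 * (r:ℂ) ^ p.2)‖) ?_ ?_ ?_ ?_ ?_
  · have hF : ∀ p : ℕ × ℕ, ∫ x in (-(Real.pi/2))..(Real.pi/2), F p x =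
        (-1) ^ d * A p.1 * B p.2 * r ^ (p.1 + p.2) * 
          (if (d : ℤ) + p.1 - p.2 = 0 then (Real.pi : ℂ) else 0) := by
      intro p
      rw [← mc_fourier, ← intervalIntegral.integral_const_mul]
      congr 1; ext x
      have h0 := Complex.exp_ne_zero (-2 * Complex.I * (x:ℂ))
      simp only [F]
      rw [zpow_sub₀ h0, zpow_add₀ h0, neg_pow, mul_pow, mul_pow]
      simp only [zpow_natCast, inv_pow]
      field_simp
      ring
    simp_rw [hF] at key
    have inj : Function.Injective (fun m : ℕ => (m, m + d)) := fun x y h => by simpa using h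
    rw [← inj.hasSum_iff] at key
    · refine mc_congr key fun m => ?_
      simp only [Function.comp_apply]
      rw [if_pos (by push_cast; ring)]
      simp only [hA, hB]
      push_cast
      ring
    · rintro ⟨x, y⟩ h
      rw [if_neg, mul_zero]
      intro h'
      apply h
      exact ⟨x, by ext <;> simp; simp at h'; omega⟩
  · intro p
    apply Continuous.aestronglyMeasurable
    have : ∀ x : ℝ, (Complex.exp (-2 * Complex.I * (x:ℂ)))≠ 0 := fun x => Complex.exp_ne_zero _
    fun_prop (disch := assumption)
  · intro p
    refine Filter.Eventually.of_forall fun x _ => ?_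
    simp only [F, norm_mul, norm_pow, norm_neg, norm_inv, hwn]
    simp
  · exact Filter.Eventually.of_forall fun x _ => sAB
  · exact intervalIntegrable_const
  · refine Filter.Eventually.of_forall fun x _ => ?_
    have h1 := mc_binom a (r * Complex.exp (-2 * Complex.I * (x:ℂ)))
      (by rw [norm_mul, hwn, mul_one]; exact hrn)
    have h2 := mc_binom b (r * (Complex.exp (-2 * Complex.I * (x:ℂ)))⁻¹)
      (by rw [norm_mul, norm_inv, hwn, inv_one, mul_one]; exact hrn)
    have h4 := mc_mul h1 h2 ((-Complex.exp (-2 * Complex.I * (x:ℂ))) ^ d)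
    rw [← mul_assoc ((-Complex.exp (-2 * Complex.I * (x:ℂ))) ^ d) (_ ^ (-(a : ℂ)))] at h4
    exact h4

theorem mc_point (s : ℝ) (k : ℤ) (d : ℕ) (r : ℝ) (hr : 0 ≤ r) (hr1 : r < 1) (x : ℝ)
    (hx : x ∈ Set.Ioo (-(Real.pi / 2)) (Real.pi / 2)) :
    |1 / Real.cos x ^ 2| • ((((((1 + r) / (1 - r)) ^ s : ℝ)) : ℂ) *
        ((((1 + r) / (1 - r) : ℝ) : ℂ) * (Real.tan x : ℂ) - Complex.I) ^ ((k : ℂ) - (s : ℂ)) *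
        ((((1 + r) / (1 - r) : ℝ) : ℂ) * (Real.tan x : ℂ) + Complex.I) ^ (-(k : ℂ) - (s : ℂ)) *
        (starRingEnd ℂ)
          (((Real.tan x : ℂ) - Complex.I) ^ (((k + d : ℤ) : ℂ) - 1 + (s : ℂ)) *
            ((Real.tan x : ℂ) + Complex.I) ^ (-((k + d : ℤ) : ℂ) - 1 + (s : ℂ)))) =
    (((1 - r ^ 2) ^ s : ℝ) : ℂ) * ((-Complex.exp (-2 * Complex.I * (x:ℂ))) ^ d *
        (1 - r * Complex.exp (-2 * Complex.I * (x:ℂ))) ^ (-((s - k : ℝ) : ℂ)) *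
        (1 - r * (Complex.exp (-2 * Complex.I * (x:ℂ)))⁻¹) ^ (-((s + k : ℝ) : ℂ))) := by
  have hc : 0 < Real.cos x := Real.cos_pos_of_mem_Ioo hx
  have hcC : (Real.cos x : ℂ) ≠ 0 := by exact_mod_cast hc.ne'
  have h1r : 0 < 1 - r := by linarith
  have h1rC : (1 - r : ℂ) ≠ 0 := by exact_mod_cast h1r.ne'
  set L : ℝ := (1 + r) / (1 - r) with hL
  have hLpos : 0 < L := by positivity
  set w : ℂ := Complex.exp (-2 * Complex.I * (x:ℂ)) with hw
  set e : ℂ := Complex.exp (Complex.I * (x:ℂ)) with he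
  have he0 : e ≠ 0 := Complex.exp_ne_zero _
  have hwe : w = (e ^ 2)⁻¹ := by
    rw [he, hw, ← Complex.exp_nat_mul, ← Complex.exp_neg]; congr 1; push_cast; ring
  have hw0 : w ≠ 0 := Complex.exp_ne_zero _
  have hen : ‖e‖ = 1 := by rw [he, Complex.norm_exp]; simp
  have hwn : ‖w‖ = 1 := by rw [hw, Complex.norm_exp]; simp
  have hce : starRingEnd ℂ e = e⁻¹ := by
    rw [he, ← Complex.exp_conj, ← Complex.exp_neg]; congr 1; simp
  have hcw : starRingEnd ℂ w = w⁻¹ := by rw [hwe]; simp [hce]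
  set u : ℂ := 1 - r * w with hu
  have hcu : starRingEnd ℂ u = 1 - r * w⁻¹ := by simp [hu, hcw]
  have hure : 0 < u.re := by
    have h1 : w.re ≤ 1 := hwn ▸ Complex.re_le_norm w
    have : u.re = 1 - r * w.re := by simp [hu]
    rw [this]; nlinarith
  have hu0 : u ≠ 0 := by intro h; rw [h] at hure; simp at hure
  have huarg : u.arg ≠ Real.pi := (Complex.mem_slitPlane_iff_arg.1 (Or.inl hure)).1
  have hcu0 : starRingEnd ℂ u ≠ 0 := by simpa using hu0
  -- trigonometric facts
  have hcos : (Real.cos x : ℂ) = (e + e⁻¹) / 2 := by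
    rw [Complex.ofReal_cos, Complex.cos, he, ← Complex.exp_neg]; congr 3 <;> ring_nf
  have hsin : (Real.sin x : ℂ) = (e⁻¹ - e) * Complex.I / 2 := by
    rw [Complex.ofReal_sin, Complex.sin, he, ← Complex.exp_neg]; congr 4 <;> ring_nf
  have htan : (Real.tan x : ℂ) = Real.sin x / Real.cos x := by
    rw [Real.tan_eq_sin_div_cos]; push_cast; rfl
  have hI := Complex.I_sq
  set z : ℂ := (L : ℂ) * (Real.tan x : ℂ) - Complex.I with hz
  have hzc : starRingEnd ℂ z = (L : ℂ) * (Real.tan x : ℂ) + Complex.I := by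
    simp only [hz, map_sub, map_mul, Complex.conj_ofReal, Complex.conj_I]; ring
  set v : ℂ := (Real.tan x : ℂ) + Complex.I with hv
  have hvc : starRingEnd ℂ v = (Real.tan x : ℂ) - Complex.I := by
    simp only [hv, map_add, Complex.conj_ofReal, Complex.conj_I]; ring
  have hzim : z.im = -1 := by simp [hz]
  have hvim : v.im = 1 := by simp [hv]
  have hz0 : z ≠ 0 := by intro h; rw [h] at hzim; simp at hzim
  have hv0 : v ≠ 0 := by intro h; rw [h] at hvim; simp at hvim
  have hzarg : z.arg ≠ Real.pi :=
    (Complex.mem_slitPlane_iff_arg.1 (Or.inr (by rw [hzim]; norm_num))).1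
  have hvarg : v.arg ≠ Real.pi :=
    (Complex.mem_slitPlane_iff_arg.1 (Or.inr (by rw [hvim]; norm_num))).1
  have hcz0 : starRingEnd ℂ z ≠ 0 := by simpa using hz0
  have hcv0 : starRingEnd ℂ v ≠ 0 := by simpa using hv0
  have hzu : z * Real.cos x * (1 - r) = -Complex.I * e * u := by
    have : z * Real.cos x = L * Real.sin x - Complex.I * Real.cos x := by
      rw [hz, htan]; field_simp
    rw [this, hcos, hsin, hu, hwe, hL]
    push_cast
    field_simp
    ring
  have hvu : v * Real.cos x = Complex.I * e⁻¹ := by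
    have : v * Real.cos x = Real.sin x + Complex.I * Real.cos x := by
      rw [hv, htan]; field_simp
    rw [this, hcos, hsin]
    ring
  have hzn : ‖z‖ * Real.cos x * (1 - r) = ‖u‖ := by
    have h := congrArg norm hzu
    rw [norm_mul, norm_mul, norm_mul, norm_mul, norm_neg, Complex.norm_I, hen,
      Complex.norm_real, Real.norm_of_nonneg hc.le] at h
    have h' : ‖(1 - r : ℂ)‖ = 1 - r := by
      rw [← Complex.ofReal_one, ← Complex.ofReal_sub, Complex.norm_real, Real.norm_of_nonneg h1r.le]
    rw [h'] at h; linarith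
  have hvn : ‖v‖ = (Real.cos x)⁻¹ := by
    have h := congrArg norm hvu
    rw [norm_mul, norm_mul, norm_inv, Complex.norm_I, hen,
      Complex.norm_real, Real.norm_of_nonneg hc.le] at h
    field_simp; linarith
  have hzr : z / starRingEnd ℂ z = (-w)⁻¹ * (u / starRingEnd ℂ u) := by
    have h := congrArg (starRingEnd ℂ) hzu
    simp only [map_mul, map_sub, map_neg, map_one, Complex.conj_ofReal, Complex.conj_I, hce] at h
    have h1 : z = -Complex.I * e * u / (Real.cos x * (1 - r)) := by
      rw [← hzu]; field_simp
    have h2 : starRingEnd ℂ z = Complex.I * e⁻¹ * starRingEnd ℂ u / (Real.cos x * (1 - r)) := by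
      rw [eq_div_iff (mul_ne_zero hcC h1rC)]; linear_combination h
    rw [h2]; nth_rw 1 [h1]
    rw [hwe]
    have := Complex.I_ne_zero
    field_simp
  have hvr : v / starRingEnd ℂ v = -w := by
    have h := congrArg (starRingEnd ℂ) hvu
    simp only [map_mul, map_inv₀, Complex.conj_ofReal, Complex.conj_I, hce] at h
    have h1 : v = Complex.I * e⁻¹ / Real.cos x := by
      rw [← hvu]; field_simp
    have h2 : starRingEnd ℂ v = -Complex.I * e / Real.cos x := by
      rw [eq_div_iff hcC, h]; simp
    rw [h2]; nth_rw 1 [h1]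
    rw [hwe]
    have := Complex.I_ne_zero
    field_simp
  have E1 := mc_cpow z hzarg hz0 k s
  have E2 := mc_cpow v hvarg hv0 (k + d) (1 - s)
  have E3 := mc_cpow u huarg hu0 k s
  have E4 : (starRingEnd ℂ)
          (((Real.tan x : ℂ) - Complex.I) ^ (((k + d : ℤ) : ℂ) - 1 + (s : ℂ)) *
            v ^ (-((k + d : ℤ) : ℂ) - 1 + (s : ℂ))) =
      v ^ (((k + d : ℤ) : ℂ) - ((1 - s : ℝ) : ℂ)) *
        (starRingEnd ℂ v) ^ (-((k + d : ℤ) : ℂ) - ((1 - s : ℝ) : ℂ)) := by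
    rw [← hvc, map_mul, Complex.conj_cpow v _ hvarg, Complex.conj_cpow v _ hvarg, Complex.conj_conj]
    congr 2
    · simp; ring_nf
    · simp; ring_nf
  rw [E4, E2, mul_assoc (((L ^ s : ℝ)) : ℂ), ← hzc, E1]
  have E5 : -((s - k : ℝ) : ℂ) = (k : ℂ) - s := by push_cast; ring
  have E6 : -((s + k : ℝ) : ℂ) = -(k : ℂ) - s := by push_cast; ring
  rw [E5, E6, mul_assoc ((-w) ^ d), ← hcu, E3, hzr, hvr, mul_zpow]
  have hreal : |1 / Real.cos x ^ 2| * (L ^ s * ‖z‖ ^ (-2 * s) * ‖v‖ ^ (-2 * (1 - s))) =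
      (1 - r ^ 2) ^ s * ‖u‖ ^ (-2 * s) := by
    have hz' : 0 < ‖z‖ := norm_pos_iff.2 hz0
    rw [abs_of_pos (by positivity), hvn, ← hzn, Real.mul_rpow (by positivity) h1r.le,
      Real.mul_rpow hz'.le hc.le]
    have a1 : 1 - r ^ 2 = L * (1 - r) ^ (2:ℝ) := by
      rw [hL, Real.rpow_two]; field_simp; ring
    have a2 : (Real.cos x)⁻¹ ^ (-2 * (1 - s)) = Real.cos x ^ (-2 * s) * Real.cos x ^ 2 := by
      rw [Real.inv_rpow hc.le, ← Real.rpow_neg hc.le, ← Real.rpow_two, ← Real.rpow_add hc]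
      congr 1; ring
    have a3 : (1 - r) ^ (2 * s) * (1 - r) ^ (-2 * s) = 1 := by
      rw [← Real.rpow_add h1r]; ring_nf; simp
    rw [a1, a2, Real.mul_rpow hLpos.le (by positivity), ← Real.rpow_mul h1r.le]
    have : L ^ s * (1 - r) ^ (2 * s) * (‖z‖ ^ (-2 * s) * Real.cos x ^ (-2 * s) * (1 - r) ^ (-2 * s))
      = L ^ s * (‖z‖ ^ (-2 * s) * Real.cos x ^ (-2 * s)) *
        ((1 - r) ^ (2 * s) * (1 - r) ^ (-2 * s)) := by ring
    rw [this, a3]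
    field_simp
  have hrealC := congrArg (fun t : ℝ => (t : ℂ)) hreal
  simp only [Complex.ofReal_mul] at hrealC
  have hwk : (-w)⁻¹ ^ k * (-w) ^ (k + (d:ℤ)) = (-w) ^ d := by
    have hnw : -w ≠ 0 := neg_ne_zero.2 hw0
    rw [inv_zpow, zpow_add₀ hnw, zpow_natCast, inv_mul_cancel_left₀ (zpow_ne_zero _ hnw)]
  rw [Complex.real_smul]
  linear_combination (u / starRingEnd ℂ u) ^ k * (-w) ^ d * hrealC +
    (|1 / Real.cos x ^ 2| : ℝ) * ((L ^ s : ℝ) : ℂ) * ((‖z‖ ^ (-2 * s) : ℝ) : ℂ) *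
      ((‖v‖ ^ (-2 * (1 - s)) : ℝ) : ℂ) * (u / starRingEnd ℂ u) ^ k * hwk

theorem mc_cont (a b : ℝ) (d : ℕ) (r : ℝ) (hr : 0 ≤ r) (hr1 : r < 1) :
    Continuous fun x : ℝ => ((-Complex.exp (-2 * Complex.I * (x:ℂ))) ^ d *
        (1 - r * Complex.exp (-2 * Complex.I * (x:ℂ))) ^ (-(a : ℂ)) *
        (1 - r * (Complex.exp (-2 * Complex.I * (x:ℂ)))⁻¹) ^ (-(b : ℂ))) := by
  have hs : ∀ w : ℂ, ‖w‖ = 1 → 1 - r * w ∈ Complex.slitPlane := by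
    intro w hw
    left
    have h1 : w.re ≤ 1 := hw ▸ Complex.re_le_norm w
    have : (1 - r * w).re = 1 - r * w.re := by simp
    rw [this]; nlinarith
  have hwn : ∀ x : ℝ, ‖Complex.exp (-2 * Complex.I * (x:ℂ))‖ = 1 := by
    intro x; rw [Complex.norm_exp]; simp
  have hne : ∀ x : ℝ, Complex.exp (-2 * Complex.I * (x:ℂ)) ≠ 0 := fun x => Complex.exp_ne_zero _
  refine ((by fun_prop : Continuous _).mul (Continuous.cpow ?_ continuous_const ?_)).mul
    (Continuous.cpow ?_ continuous_const ?_)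
  · fun_prop
  · exact fun x => hs _ (hwn x)
  · fun_prop (disch := assumption)
  · exact fun x => hs _ (by rw [norm_inv, hwn, inv_one])

theorem mc_ne (s : ℝ) (hs : 1/2 < s) (hs1 : s < 1) (k : ℤ) (m : ℕ) : s + k ≠ -m := by
  intro h
  have h1 : s = ((-m - k : ℤ) : ℝ) := by push_cast; linarith
  have h2 : (0:ℝ) < ((-m - k : ℤ) : ℝ) := by rw [← h1]; linarith
  have h3 : ((-m - k : ℤ) : ℝ) < 1 := by rw [← h1]; exact hs1
  have h4 : (0:ℤ) < -m - k := by exact_mod_cast h2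
  have h5 : (-m - k : ℤ) < 1 := by exact_mod_cast h3
  omega

theorem mc_gamma (b : ℝ) (hb : ∀ m : ℕ, b ≠ -m) (d : ℕ) :
    Real.Gamma (b + d) / Real.Gamma b = (ascPochhammer ℝ d).eval b := by
  have h0 := Real.Gamma_ne_zero hb
  rw [div_eq_iff h0]
  induction d with
  | zero => simp
  | succ d ih =>
    have h1 : b + d ≠ 0 := fun h => hb d (by linarith)
    rw [ascPochhammer_succ_eval, Nat.cast_succ, ← add_assoc, Real.Gamma_add_one h1, ih]
    ring

theorem matrix_coefficient_integral (s : ℝ) (hs : 1/2 < s) (hs1 : s < 1) (n k : ℤ) (hnk : k ≤ n)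
    (r : ℝ) (hr : 0 ≤ r) (hr1 : r < 1) :
    Integrable (fun x : ℝ =>
      (((((1 + r) / (1 - r)) ^ s : ℝ)) : ℂ) *
        ((((1 + r) / (1 - r) : ℝ) : ℂ) * (x : ℂ) - Complex.I) ^ ((k : ℂ) - (s : ℂ)) *
        ((((1 + r) / (1 - r) : ℝ) : ℂ) * (x : ℂ) + Complex.I) ^ (-(k : ℂ) - (s : ℂ)) *
        (starRingEnd ℂ)
          (((x : ℂ) - Complex.I) ^ ((n : ℂ) - 1 + (s : ℂ)) *
            ((x : ℂ) + Complex.I) ^ (-(n : ℂ) - 1 + (s : ℂ)))) ∧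
    ∫ x : ℝ,
        (((((1 + r) / (1 - r)) ^ s : ℝ)) : ℂ) *
          ((((1 + r) / (1 - r) : ℝ) : ℂ) * (x : ℂ) - Complex.I) ^ ((k : ℂ) - (s : ℂ)) *
          ((((1 + r) / (1 - r) : ℝ) : ℂ) * (x : ℂ) + Complex.I) ^ (-(k : ℂ) - (s : ℂ)) *
          (starRingEnd ℂ)
            (((x : ℂ) - Complex.I) ^ ((n : ℂ) - 1 + (s : ℂ)) *
              ((x : ℂ) + Complex.I) ^ (-(n : ℂ) - 1 + (s : ℂ)))
      = ((-1 : ℂ) ^ (k + n) * (Real.pi : ℂ) / ((Real.Gamma (1 + (n : ℝ) - (k : ℝ)) : ℝ) : ℂ)) *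
          ((Real.Gamma (s + (n : ℝ)) / Real.Gamma (s + (k : ℝ)) : ℝ) : ℂ) *
          ((Phi s n k r : ℝ) : ℂ) := by
  obtain ⟨d, rfl⟩ : ∃ d : ℕ, n = k + d := ⟨(n - k).toNat, by omega⟩
  set g : ℝ → ℂ := fun x : ℝ =>
      (((((1 + r) / (1 - r)) ^ s : ℝ)) : ℂ) *
        ((((1 + r) / (1 - r) : ℝ) : ℂ) * (x : ℂ) - Complex.I) ^ ((k : ℂ) - (s : ℂ)) *
        ((((1 + r) / (1 - r) : ℝ) : ℂ) * (x : ℂ) + Complex.I) ^ (-(k : ℂ) - (s : ℂ)) *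
        (starRingEnd ℂ)
          (((x : ℂ) - Complex.I) ^ (((k + d : ℤ) : ℂ) - 1 + (s : ℂ)) *
            ((x : ℂ) + Complex.I) ^ (-((k + d : ℤ) : ℂ) - 1 + (s : ℂ))) with hg
  set G : ℝ → ℂ := fun x : ℝ => ((-Complex.exp (-2 * Complex.I * (x:ℂ))) ^ d *
        (1 - r * Complex.exp (-2 * Complex.I * (x:ℂ))) ^ (-((s - k : ℝ) : ℂ)) *
        (1 - r * (Complex.exp (-2 * Complex.I * (x:ℂ)))⁻¹) ^ (-((s + k : ℝ) : ℂ))) with hG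
  have hpt : ∀ x ∈ Set.Ioo (-(Real.pi / 2)) (Real.pi / 2),
      |1 / Real.cos x ^ 2| • g (Real.tan x) = (((1 - r ^ 2) ^ s : ℝ) : ℂ) * G x :=
    fun x hx => mc_point s k d r hr hr1 x hx
  have hder : ∀ x ∈ Set.Ioo (-(Real.pi / 2)) (Real.pi / 2),
      HasDerivWithinAt Real.tan (1 / Real.cos x ^ 2) (Set.Ioo (-(Real.pi / 2)) (Real.pi / 2)) x :=
    fun x hx => (Real.hasDerivAt_tan_of_mem_Ioo hx).hasDerivWithinAt
  have hGc : Continuous G := mc_cont _ _ d r hr hr1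
  have hpi : -(Real.pi / 2) ≤ Real.pi / 2 := by linarith [Real.pi_pos]
  have hsum := mc_sum (s - k) (s + k) d r hr hr1
  constructor
  · rw [← integrableOn_univ, ← Real.image_tan_Ioo,
      integrableOn_image_iff_integrableOn_abs_deriv_smul measurableSet_Ioo hder Real.injOn_tan]
    rw [integrableOn_congr_fun hpt measurableSet_Ioo]
    exact ((continuous_const.mul hGc).integrableOn_Icc).mono_set Set.Ioo_subset_Icc_self
  · rw [← setIntegral_univ, ← Real.image_tan_Ioo,
      integral_image_eq_integral_abs_deriv_smul measurableSet_Ioo hder Real.injOn_tan,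
      setIntegral_congr_fun measurableSet_Ioo hpt, integral_const_mul,
      ← integral_Ioc_eq_integral_Ioo, ← intervalIntegral.integral_of_le hpi]
    have hval := hsum.tsum_eq
    rw [tsum_mul_left, ← Complex.ofReal_tsum] at hval
    rw [← hval]
    have hgam := mc_gamma (s + k) (mc_ne s hs hs1 k) d
    have hnat : ((k + d : ℤ) - k).natAbs = d := by simp
    have hF : (∑' m : ℕ, (((ascPochhammer ℝ m).eval (s - k) / (Nat.factorial m)) *
          ((ascPochhammer ℝ (m + d)).eval (s + k) / (Nat.factorial (m + d))) * r ^ (2 * m + d))) =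
        (1 / Real.Gamma (1 + ((k + d : ℤ) : ℝ) - (k : ℝ))) *
          (Real.Gamma (s + ((k + d : ℤ) : ℝ)) / Real.Gamma (s + k)) *
          (r ^ d * hyperF (s - k) (s + ((k + d : ℤ) : ℝ)) (1 + (d : ℕ)) (r ^ 2)) := by
      have c1 : Real.Gamma (1 + ((k + d : ℤ) : ℝ) - (k : ℝ)) = Nat.factorial d := by
        rw [← Real.Gamma_nat_eq_factorial]; congr 1; push_cast; ring
      have c2 : s + ((k + d : ℤ) : ℝ) = s + k + d := by push_cast; ring
      rw [c1, c2, hgam, hyperF, ← tsum_mul_left, ← tsum_mul_left]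
      congr 1; ext m
      have p1 := congrArg (Polynomial.eval (s + k : ℝ)) (ascPochhammer_mul ℝ d m)
      simp only [Polynomial.eval_mul, Polynomial.eval_comp, Polynomial.eval_add, Polynomial.eval_X,
        Polynomial.eval_natCast] at p1
      have p2 := factorial_mul_ascPochhammer ℝ d m
      rw [add_comm m d, ← p1, ← p2, add_comm (d : ℝ) 1]
      have q1 : (Nat.factorial d : ℝ) ≠ 0 := by positivity
      have q2 : (Nat.factorial m : ℝ) ≠ 0 := by positivity
      have q3 : (ascPochhammer ℝ m).eval (1 + d : ℝ) ≠ 0 := by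
        intro h0; rw [add_comm (d : ℝ) 1, h0, mul_zero] at p2
        have : (Nat.factorial (d + m) : ℝ) ≠ 0 := by positivity
        exact this p2.symm
      field_simp
      ring
    rw [hF, Phi, hnat, eps, if_pos hnk, one_mul, one_mul]
    have hsgn : (-1 : ℂ) ^ (k + (k + (d : ℤ))) = (-1) ^ d := by
      rw [← add_assoc, zpow_add₀ (by norm_num), zpow_natCast, ← two_mul, zpow_mul]; simp
    rw [hsgn]
    push_cast
    ring
end

section
/- Let δ ∈ ℝ with 1/2 < δ < 1, and let μ be a finite Borel measure on the interval [0, π). Then for every r with 0 ≤ r < 1 and every θ ∈ ℝ, the family n ↦ (Γ(δ + |n|)/(Γ(δ)·Γ(1 + |n|))) · (∫_{[0,π)} e^{−2inα} dμ(α)) · r^{|n|} · F(δ, δ + |n|; 1 + |n|; r²) · e^{2inθ}, indexed by n ∈ ℤ, is absolutely summable, and its sum equals ∫_{[0,π)} ( r² − 2r·cos(2(θ − α)) + 1 )^{−δ} dμ(α). (Equivalently: the 2n-th Fourier coefficient in θ of the Poisson-type integral ∫ ((1 − r²)/|r e^{2iθ} − e^{2iα}|²)^δ dμ(α) equals (1−r²)^δ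 r^{|n|} F(δ, δ+|n|; 1+|n|; r²) times (Γ(δ+|n|)/(Γ(δ)Γ(1+|n|)))·μ̂(−2n), where μ̂(−2n) = ∫ e^{−2inα} dμ(α).) -/
open MeasureTheory

/-- The n-th term of the Fourier expansion of the Poisson-type integral. -/
noncomputable def fourierTerm (δ : ℝ) (μ : Measure ℝ) (r θ : ℝ) (n : ℤ) : ℂ :=
  ((Real.Gamma (δ + (n.natAbs : ℝ)) / (Real.Gamma δ * Real.Gamma (1 + (n.natAbs : ℝ))) : ℝ) : ℂ) *
    (∫ α in Set.Ico 0 Real.pi, Complex.exp (-2 * Complex.I * (n : ℂ) * (α : ℂ)) ∂μ) *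
    ((r ^ n.natAbs : ℝ) : ℂ) *
    ((hyperF δ (δ + (n.natAbs : ℝ)) (1 + (n.natAbs : ℝ)) (r ^ 2) : ℝ) : ℂ) *
    Complex.exp (2 * Complex.I * (n : ℂ) * (θ : ℂ))

/-- Coefficients of `(1 - z) ^ (-δ)`. -/
noncomputable def binC (δ : ℝ) (k : ℕ) : ℝ := (ascPochhammer ℝ k).eval δ / (Nat.factorial k : ℝ)

lemma binC_nonneg (δ : ℝ) (hδ : 0 < δ) (k : ℕ) : 0 ≤ binC δ k :=
  div_nonneg (ascPochhammer_pos k δ hδ).le (Nat.cast_nonneg _)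

lemma ring_choose_eq_binC (δ : ℝ) (k : ℕ) :
    Ring.choose ((δ : ℂ) + k - 1) k = (binC δ k : ℂ) := by
  have h0 : (k.factorial : ℂ) ≠ 0 := by exact_mod_cast k.factorial_ne_zero
  have h := Ring.factorial_nsmul_multichoose_eq_ascPochhammer (δ : ℂ) k
  rw [Polynomial.ascPochhammer_smeval_cast, Polynomial.ascPochhammer_smeval_eq_eval,
    nsmul_eq_mul] at h
  rw [← Ring.multichoose_eq, binC, Complex.ofReal_div, Complex.ofReal_natCast, eq_div_iff h0,
    mul_comm, h]
  have := ascPochhammer_eval₂ Complex.ofRealHom k δ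
  rw [this]
  exact Polynomial.eval₂_at_apply Complex.ofRealHom δ

lemma hasSum_binC (δ : ℝ) (z : ℂ) (hz : ‖z‖ < 1) :
    HasSum (fun k : ℕ => (binC δ k : ℂ) * z ^ k) (1 / (1 - z) ^ (δ : ℂ)) := by
  have h := (Complex.one_div_one_sub_cpow_hasFPowerSeriesOnBall_zero (δ : ℂ)).hasSum
    (y := z) (by simpa [enorm_eq_nnnorm] using (by exact_mod_cast hz : ‖z‖₊ < 1))
  simpa [FormalMultilinearSeries.ofScalars, ring_choose_eq_binC] using h

/-- `(n, m) ↦ (m + n⁺, m + n⁻)`. -/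
def diagEquiv : ℤ × ℕ ≃ ℕ × ℕ where
  toFun p := (p.2 + p.1.toNat, p.2 + (-p.1).toNat)
  invFun q := ((q.1 : ℤ) - q.2, min q.1 q.2)
  left_inv p := by ext <;> simp <;> omega
  right_inv p := by ext <;> simp <;> omega

lemma coeff_identity (δ : ℝ) (hδ : 0 < δ) (N m : ℕ) :
    binC δ (m + N) * binC δ m = Real.Gamma (δ + N) / (Real.Gamma δ * Real.Gamma (1 + N)) *
      ((ascPochhammer ℝ m).eval δ * (ascPochhammer ℝ m).eval (δ + N) /
        ((ascPochhammer ℝ m).eval (1 + (N : ℝ)) * (Nat.factorial m))) := by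
  have hG : Real.Gamma (δ + N) = (ascPochhammer ℝ N).eval δ * Real.Gamma δ := by
    induction N with
    | zero => simp
    | succ N ih =>
      rw [ascPochhammer_succ_eval]
      push_cast
      rw [← add_assoc, Real.Gamma_add_one (by positivity), ih]; ring
  have hG0 : Real.Gamma δ ≠ 0 := (Real.Gamma_pos_of_pos hδ).ne'
  have hN : Real.Gamma (1 + N) = N.factorial := by rw [add_comm, Real.Gamma_nat_eq_factorial]
  have hm : (ascPochhammer ℝ (m + N)).eval δ =
      (ascPochhammer ℝ N).eval δ * (ascPochhammer ℝ m).eval (δ + N) := by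
    rw [add_comm m N, ← ascPochhammer_mul]; simp
  have hf : ((m + N).factorial : ℝ) = N.factorial * (ascPochhammer ℝ m).eval (1 + (N : ℝ)) := by
    rw [add_comm m N, add_comm (1 : ℝ), factorial_mul_ascPochhammer]
  have h1 : (ascPochhammer ℝ m).eval (1 + (N : ℝ)) ≠ 0 :=
    (ascPochhammer_pos m _ (by positivity)).ne'
  have h2 : (N.factorial : ℝ) ≠ 0 := by exact_mod_cast N.factorial_ne_zero
  have h3 : (m.factorial : ℝ) ≠ 0 := by exact_mod_cast m.factorial_ne_zero
  rw [binC, binC, hG, hN, hm, hf]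
  field_simp

/-- The radial coefficient. -/
noncomputable def radC (δ r : ℝ) (n : ℤ) : ℝ :=
  (Real.Gamma (δ + (n.natAbs : ℝ)) / (Real.Gamma δ * Real.Gamma (1 + (n.natAbs : ℝ)))) *
    r ^ n.natAbs * hyperF δ (δ + (n.natAbs : ℝ)) (1 + (n.natAbs : ℝ)) (r ^ 2)

lemma tsum_diag (δ r : ℝ) (hδ : 0 < δ) (n : ℤ) :
    ∑' m : ℕ, (binC δ (m + n.toNat) * r ^ (m + n.toNat)) *
      (binC δ (m + (-n).toNat) * r ^ (m + (-n).toNat)) = radC δ r n := by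
  rw [radC, hyperF, ← tsum_mul_left]
  congr 1
  ext m
  have h : (binC δ (m + n.toNat) * r ^ (m + n.toNat)) *
      (binC δ (m + (-n).toNat) * r ^ (m + (-n).toNat)) =
      (binC δ (m + n.natAbs) * binC δ m) * (r ^ n.natAbs * (r ^ 2) ^ m) := by
    rcases le_total 0 n with h | h
    · rw [show n.toNat = n.natAbs by omega, show (-n).toNat = 0 by omega]; simp only [add_zero]; ring
    · rw [show (-n).toNat = n.natAbs by omega, show n.toNat = 0 by omega]; simp only [add_zero]; ring
  rw [h, coeff_identity δ hδ]; ring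

lemma zpow_split (u : ℂ) (hu0 : u ≠ 0) (n : ℤ) (m : ℕ) :
    u ^ n = u ^ (m + n.toNat) * (u⁻¹) ^ (m + (-n).toNat) := by
  have h : n = ((m + n.toNat : ℕ) : ℤ) + -((m + (-n).toNat : ℕ) : ℤ) := by omega
  rw [inv_pow, ← zpow_natCast, ← zpow_natCast, ← zpow_neg, ← zpow_add₀ hu0, ← h]

lemma term_split (δ r : ℝ) (u : ℂ) (hu0 : u ≠ 0) (hcu : (starRingEnd ℂ) u = u⁻¹)
    (n : ℤ) (m : ℕ) :
    (binC δ (m + n.toNat) : ℂ) * (r * u) ^ (m + n.toNat) *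
      (starRingEnd ℂ) ((binC δ (m + (-n).toNat) : ℂ) * (r * u) ^ (m + (-n).toNat)) =
    (((binC δ (m + n.toNat) * r ^ (m + n.toNat)) *
      (binC δ (m + (-n).toNat) * r ^ (m + (-n).toNat)) : ℝ) : ℂ) * u ^ n := by
  rw [zpow_split u hu0 n m]
  generalize m + n.toNat = j
  generalize m + (-n).toNat = k
  simp only [map_mul, map_pow, Complex.conj_ofReal, hcu, mul_pow]
  push_cast
  ring

lemma hasSum_mul_gen (f g : ℕ → ℂ) (s t : ℂ) (hf : HasSum f s) (hg : HasSum g t) :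
    HasSum (fun x : ℕ × ℕ => f x.1 * g x.2) (s * t) := by
  have h : Summable (fun x : ℕ × ℕ => f x.1 * g x.2) :=
    summable_mul_of_summable_norm hf.summable.norm hg.summable.norm
  exact hf.mul hg h

lemma hasSum_conj_mul (δ r : ℝ) (hδ : 0 < δ) (u s : ℂ) (hun : ‖u‖ = 1)
    (hs : HasSum (fun k : ℕ => (binC δ k : ℂ) * (r * u) ^ k) s) :
    HasSum (fun n : ℤ => (radC δ r n : ℂ) * u ^ n) (s * (starRingEnd ℂ) s) := by
  have hu0 : u ≠ 0 := by rintro rfl; simp at hun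
  have hcu : (starRingEnd ℂ) u = u⁻¹ := by
    rw [Complex.inv_def, Complex.normSq_eq_norm_sq, hun]; simp
  have hc : HasSum (fun k : ℕ => (starRingEnd ℂ) ((binC δ k : ℂ) * (r * u) ^ k))
      ((starRingEnd ℂ) s) :=
    Complex.hasSum_conj'.mpr (by simpa only [Complex.conj_conj] using hs)
  have hp := hasSum_mul_gen _ _ _ _ hs hc
  rw [← diagEquiv.hasSum_iff] at hp
  have hterm : ((fun x : ℕ × ℕ => (binC δ x.1 : ℂ) * (r * u) ^ x.1 *
      (starRingEnd ℂ) ((binC δ x.2 : ℂ) * (r * u) ^ x.2)) ∘ diagEquiv) =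
      fun p : ℤ × ℕ => (((binC δ (p.2 + p.1.toNat) * r ^ (p.2 + p.1.toNat)) *
      (binC δ (p.2 + (-p.1).toNat) * r ^ (p.2 + (-p.1).toNat)) : ℝ) : ℂ) * u ^ p.1 := by
    funext p
    exact term_split δ r u hu0 hcu p.1 p.2
  rw [hterm] at hp
  refine hp.prod_fiberwise fun n => ?_
  have hf := (hp.summable.prod_factor n).hasSum
  dsimp only at hf
  rw [tsum_mul_right, ← Complex.ofReal_tsum, tsum_diag δ r hδ] at hf
  exact hf

lemma norm_value (δ r φ : ℝ) :
    1 / (1 - (r : ℂ) * Complex.exp (φ * Complex.I)) ^ (δ : ℂ) *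
      (starRingEnd ℂ) (1 / (1 - (r : ℂ) * Complex.exp (φ * Complex.I)) ^ (δ : ℂ)) =
      (((r ^ 2 - 2 * r * Real.cos φ + 1) ^ (-δ) : ℝ) : ℂ) := by
  have hsq : r ^ 2 - 2 * r * Real.cos φ + 1 =
      ‖1 - (r : ℂ) * Complex.exp (φ * Complex.I)‖ ^ 2 := by
    rw [← Complex.normSq_eq_norm_sq, Complex.normSq_apply, Complex.exp_mul_I,
      ← Complex.ofReal_cos, ← Complex.ofReal_sin]
    simp only [Complex.sub_re, Complex.one_re, Complex.re_ofReal_mul, Complex.add_re,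
      Complex.ofReal_re, Complex.mul_re, Complex.I_re, Complex.ofReal_im, Complex.I_im,
      Complex.sub_im, Complex.one_im, Complex.im_ofReal_mul, Complex.add_im, Complex.mul_im]
    linear_combination (-r ^ 2) * Real.sin_sq_add_cos_sq φ
  rw [Complex.mul_conj, Complex.normSq_eq_norm_sq, hsq, norm_div, norm_one,
    Complex.norm_cpow_real]
  generalize hx : ‖1 - (r : ℂ) * Complex.exp (φ * Complex.I)‖ = x
  have hx0 : 0 ≤ x := hx ▸ norm_nonneg _
  congr 1
  rw [Real.rpow_neg (by positivity), div_pow, one_pow, one_div, ← Real.rpow_natCast x 2,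
    ← Real.rpow_mul hx0, mul_comm, Real.rpow_mul hx0, Real.rpow_natCast]

lemma hasSum_pointwise (δ r φ : ℝ) (hδ : 0 < δ) (hr : 0 ≤ r) (hr1 : r < 1) :
    HasSum (fun n : ℤ => (radC δ r n : ℂ) * Complex.exp (n * (φ * Complex.I)))
      (((r ^ 2 - 2 * r * Real.cos φ + 1) ^ (-δ) : ℝ) : ℂ) := by
  have hun : ‖Complex.exp (φ * Complex.I)‖ = 1 := Complex.norm_exp_ofReal_mul_I φ
  have hz : ‖(r : ℂ) * Complex.exp (φ * Complex.I)‖ < 1 := by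
    rw [norm_mul, hun, mul_one, Complex.norm_real, Real.norm_of_nonneg hr]; exact hr1
  have h := hasSum_conj_mul δ r hδ _ _ hun (hasSum_binC δ _ hz)
  rw [norm_value] at h
  simpa only [Complex.exp_int_mul] using h

lemma summable_radC (δ r : ℝ) (hδ : 0 < δ) (hr : 0 ≤ r) (hr1 : r < 1) :
    Summable (fun n : ℤ => ‖radC δ r n‖) := by
  have h := (hasSum_pointwise δ r 0 hδ hr hr1).summable.norm
  simpa using h

theorem poisson_integral_fourier_expansion (δ : ℝ) (hδ : 1/2 < δ) (hδ1 : δ < 1)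
    (μ : Measure ℝ) [IsFiniteMeasure μ] (hμ : μ (Set.Ico 0 Real.pi)ᶜ = 0)
    (r : ℝ) (hr : 0 ≤ r) (hr1 : r < 1) (θ : ℝ) :
    Summable (fun n : ℤ => ‖fourierTerm δ μ r θ n‖) ∧
    ∑' n : ℤ, fourierTerm δ μ r θ n =
      ((∫ α in Set.Ico 0 Real.pi,
          ((r ^ 2 - 2 * r * Real.cos (2 * (θ - α)) + 1) ^ (-δ) : ℝ) ∂μ : ℝ) : ℂ) := by
  have hδ0 : 0 < δ := by linarith
  have hsum := summable_radC δ r hδ0 hr hr1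
  set ν := μ.restrict (Set.Ico 0 Real.pi)
  set F : ℤ → ℝ → ℂ := fun n α =>
    (radC δ r n : ℂ) * Complex.exp (n * ((2 * (θ - α) : ℝ) * Complex.I)) with hF
  have hcont : ∀ n, Continuous (F n) := fun n => by
    simp only [hF]; fun_prop
  have hnorm : ∀ n α, ‖F n α‖ = ‖radC δ r n‖ := fun n α => by
    have : (n : ℂ) * ((2 * (θ - α) : ℝ) * Complex.I) = ((n * (2 * (θ - α)) : ℝ) : ℂ) * Complex.I := by
      push_cast; ring
    simp only [hF]
    rw [norm_mul, this, Complex.norm_exp_ofReal_mul_I, mul_one, Complex.norm_real]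
  have hterm : ∀ n, fourierTerm δ μ r θ n = ∫ α, F n α ∂ν := fun n => by
    have : ∀ α : ℝ, F n α = ((radC δ r n : ℂ) * Complex.exp (2 * Complex.I * (n : ℂ) * (θ : ℂ))) *
        Complex.exp (-2 * Complex.I * (n : ℂ) * (α : ℂ)) := fun α => by
      simp only [hF]
      rw [mul_assoc, ← Complex.exp_add]
      congr 2
      push_cast; ring
    simp_rw [this]
    rw [integral_const_mul, fourierTerm, radC]
    push_cast
    ring
  have hs : HasSum (fun n => ∫ α, F n α ∂ν)
      (∫ α, (((r ^ 2 - 2 * r * Real.cos (2 * (θ - α)) + 1) ^ (-δ) : ℝ) : ℂ) ∂ν) := by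
    refine hasSum_integral_of_dominated_convergence (fun n _ => ‖radC δ r n‖)
      (fun n => (hcont n).aestronglyMeasurable) (fun n => ?_) ?_ ?_ ?_
    · exact Filter.Eventually.of_forall fun α => (hnorm n α).le
    · exact Filter.Eventually.of_forall fun α => hsum
    · exact integrable_const _
    · exact Filter.Eventually.of_forall fun α => hasSum_pointwise δ r _ hδ0 hr hr1
  have heq : fourierTerm δ μ r θ = fun n => ∫ α, F n α ∂ν := funext hterm
  rw [heq]
  exact ⟨hs.summable.norm, by rw [hs.tsum_eq, integral_complex_ofReal]⟩
end
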